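/- arXiv:0710.5674 — 3 statements merged into one kernel-verified Lean document; each statement's English description precedes it below -/
import Mathlib

section
/- Let (I', I_∅) be either (I'_DSKS, ⟨G_DSKS, L'_DSKS, ∅⟩) or (I'_DEO, ⟨G_DEO, L'_DEO, ∅⟩). For any finite set E of ground terms in normal form and any ground term t in normal form: E ↠*_{I'} E, t if and only if E ↠*_{I_∅} E, t; that is, derivations modulo the equational theory and derivations modulo the empty theory derive the same normal terms from normal knowledge. -/
set_option maxHeartbeats 1000000

namespace Paper

/-- First-order terms over a signature `Sg` with arities `ar`, with free
constants (indexed by `ℕ`) and variables (indexed by `ℕ`). -/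
inductive Tm (Sg : Type) (ar : Sg → ℕ) : Type where
  | var : ℕ → Tm Sg ar
  | cst : ℕ → Tm Sg ar
  | app : (s : Sg) → (Fin (ar s) → Tm Sg ar) → Tm Sg ar

variable {Sg : Type} {ar : Sg → ℕ}

/-- Substitutions. -/
abbrev Subst (Sg : Type) (ar : Sg → ℕ) := ℕ → Tm Sg ar

/-- Application of a substitution to a term. -/
def subst (σ : Subst Sg ar) : Tm Sg ar → Tm Sg ar
  | .var n => σ n
  | .cst c => .cst c
  | .app s a => .app s (fun i => subst σ (a i))

/-- Composition of substitutions: `scomp τ σ` first applies `σ`, then `τ`. -/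
def scomp (τ σ : Subst Sg ar) : Subst Sg ar := fun n => subst τ (σ n)

def isVar : Tm Sg ar → Prop
  | .var _ => True
  | _ => False

def isVarB : Tm Sg ar → Bool
  | .var _ => true
  | _ => false

/-- The set of variables of a term. -/
def vars : Tm Sg ar → Set ℕ
  | .var n => {n}
  | .cst _ => ∅
  | .app _ a => ⋃ i, vars (a i)

/-- A term is ground if it has no variables. -/
def Ground (t : Tm Sg ar) : Prop := vars t = ∅

/-- The subterm of `t` at position `p` (a sequence of argument indices). -/
def subtermAt : Tm Sg ar → List ℕ → Option (Tm Sg ar)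
  | t, [] => some t
  | .var _, _ :: _ => none
  | .cst _, _ :: _ => none
  | .app s a, i :: p => if h : i < ar s then subtermAt (a ⟨i, h⟩) p else none

/-- Replacement of the subterm at position `p` by `u`. -/
def replaceAt : Tm Sg ar → List ℕ → Tm Sg ar → Tm Sg ar
  | _, [], u => u
  | .var n, _ :: _, _ => .var n
  | .cst c, _ :: _, _ => .cst c
  | .app s a, i :: p, u => .app s (fun j => if j.1 = i then replaceAt (a j) p u else a j)

/-- The set of subterms of a term. -/
def subterms (t : Tm Sg ar) : Set (Tm Sg ar) := {u | ∃ p, subtermAt t p = some u}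

/-- The number of symbols of a term. -/
def tmSize : Tm Sg ar → ℕ
  | .var _ => 1
  | .cst _ => 1
  | .app _ a => 1 + Finset.univ.sum (fun i => tmSize (a i))

/-- One-step rewriting with the rules `R` (closed under substitution and contexts). -/
inductive Rew (R : Tm Sg ar → Tm Sg ar → Prop) : Tm Sg ar → Tm Sg ar → Prop where
  | root : ∀ (l r : Tm Sg ar) (σ : Subst Sg ar), R l r → Rew R (subst σ l) (subst σ r)
  | congr : ∀ (s : Sg) (a b : Fin (ar s) → Tm Sg ar) (i : Fin (ar s)),
      Rew R (a i) (b i) → (∀ j, j ≠ i → a j = b j) → Rew R (Tm.app s a) (Tm.app s b)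

/-- The reflexive-transitive closure of rewriting. -/
def Reduces (R : Tm Sg ar → Tm Sg ar → Prop) : Tm Sg ar → Tm Sg ar → Prop :=
  Relation.ReflTransGen (Rew R)

/-- A term is in normal form if no rewriting step applies to it. -/
def NormalForm (R : Tm Sg ar → Tm Sg ar → Prop) (t : Tm Sg ar) : Prop := ∀ u, ¬ Rew R t u

/-- A substitution is in normal form if all its images are. -/
def NormalSubst (R : Tm Sg ar → Tm Sg ar → Prop) (σ : Subst Sg ar) : Prop :=
  ∀ n, NormalForm R (σ n)

/-- Termination of rewriting: no infinite rewriting sequences. -/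
def Terminating (R : Tm Sg ar → Tm Sg ar → Prop) : Prop :=
  WellFounded (fun a b : Tm Sg ar => Rew R b a)

/-- Confluence of rewriting. -/
def Confluent (R : Tm Sg ar → Tm Sg ar → Prop) : Prop :=
  ∀ a b c : Tm Sg ar, Reduces R a b → Reduces R a c →
    ∃ d, Reduces R b d ∧ Reduces R c d

/-- Convergence: termination together with confluence. -/
def Convergent (R : Tm Sg ar → Tm Sg ar → Prop) : Prop := Terminating R ∧ Confluent R

/-- The equational theory generated by a set of axioms `A`: the smallest
congruence containing all substitution instances of the axioms. -/
inductive EqTh (A : Tm Sg ar → Tm Sg ar → Prop) : Tm Sg ar → Tm Sg ar → Prop where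
  | ax : ∀ (l r : Tm Sg ar) (σ : Subst Sg ar), A l r → EqTh A (subst σ l) (subst σ r)
  | refl : ∀ t, EqTh A t t
  | symm : ∀ {t u}, EqTh A t u → EqTh A u t
  | trans : ∀ {t u v}, EqTh A t u → EqTh A u v → EqTh A t v
  | congr : ∀ (s : Sg) (a b : Fin (ar s) → Tm Sg ar),
      (∀ i, EqTh A (a i) (b i)) → EqTh A (Tm.app s a) (Tm.app s b)

/-- `σ` unifies `u` and `v` syntactically. -/
def Unifies (σ : Subst Sg ar) (u v : Tm Sg ar) : Prop := subst σ u = subst σ v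

/-- `σ` is a most general (syntactic) unifier of `u` and `v`. -/
def IsMGU (σ : Subst Sg ar) (u v : Tm Sg ar) : Prop :=
  Unifies σ u v ∧ ∀ τ, Unifies τ u v → ∃ ρ, ∀ n, τ n = subst ρ (σ n)

def UnifiesSys (σ : Subst Sg ar) (S : List (Tm Sg ar × Tm Sg ar)) : Prop :=
  ∀ e ∈ S, subst σ e.1 = subst σ e.2

/-- `σ` is a most general (syntactic) unifier of the system `S`. -/
def IsMGUSys (σ : Subst Sg ar) (S : List (Tm Sg ar × Tm Sg ar)) : Prop :=
  UnifiesSys σ S ∧ ∀ τ, UnifiesSys τ S → ∃ ρ, ∀ n, τ n = subst ρ (σ n)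

/-- `σ` is an `H`-unifier (modulo the theory generated by `A`) of the system `S`. -/
def HUnifier (A : Tm Sg ar → Tm Sg ar → Prop) (σ : Subst Sg ar)
    (S : List (Tm Sg ar × Tm Sg ar)) : Prop :=
  ∀ e ∈ S, EqTh A (subst σ e.1) (subst σ e.2)

/-- Narrowing: `t ⤳ t'` with substitution `σ`, using a rule `l → r` of `R` at a
non-variable position `p` of `t`, where `σ = mgu(t|_p, l)`. -/
def Narrow (R : Tm Sg ar → Tm Sg ar → Prop) (t : Tm Sg ar) (σ : Subst Sg ar)
    (t' : Tm Sg ar) : Prop :=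
  ∃ l r p u, R l r ∧ subtermAt t p = some u ∧ ¬ isVar u ∧ IsMGU σ u l ∧
    t' = replaceAt (subst σ t) p (subst σ r)

/-- The non-variable positions of a term. -/
def nonVarPos (t : Tm Sg ar) : Set (List ℕ) :=
  {p | ∃ u, subtermAt t p = some u ∧ ¬ isVar u}

/-- A configuration for basic narrowing: a term with its set of basic positions. -/
abbrev Conf (Sg : Type) (ar : Sg → ℕ) := Tm Sg ar × Set (List ℕ)

/-- One basic narrowing step: narrowing at a basic position; the basic positions
of the result are those of the source not below the redex position `p`,
together with `p·q` for `q` a non-variable position of the right-hand side. -/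
def BNStep (R : Tm Sg ar → Tm Sg ar → Prop) (c : Conf Sg ar) (σ : Subst Sg ar)
    (c' : Conf Sg ar) : Prop :=
  ∃ l r p u, R l r ∧ p ∈ c.2 ∧ subtermAt c.1 p = some u ∧ ¬ isVar u ∧ IsMGU σ u l ∧
    c'.1 = replaceAt (subst σ c.1) p (subst σ r) ∧
    c'.2 = {q | q ∈ c.2 ∧ ¬ (p <+: q)} ∪ {q | ∃ q', q = p ++ q' ∧ q' ∈ nonVarPos r}

/-- Sequences of basic narrowing steps, recording the composed substitution. -/
inductive BN (R : Tm Sg ar → Tm Sg ar → Prop) : Conf Sg ar → Subst Sg ar → Conf Sg ar → Prop where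
  | refl : ∀ c, BN R c Tm.var c
  | step : ∀ {c c' c'' : Conf Sg ar} {σ θ : Subst Sg ar},
      BNStep R c σ c' → BN R c' θ c'' → BN R c (scomp θ σ) c''

/-- Basic narrowing between terms, starting with all non-variable positions basic. -/
def BNTerms (R : Tm Sg ar → Tm Sg ar → Prop) (t : Tm Sg ar) (σ : Subst Sg ar)
    (t' : Tm Sg ar) : Prop :=
  ∃ B, BN R (t, nonVarPos t) σ (t', B)

/-! ### Intruder deduction systems -/

/-- An intruder deduction rule `l ↠ r`: a set of premises and a conclusion. -/
abbrev Rule (Sg : Type) (ar : Sg → ℕ) := Set (Tm Sg ar) × Tm Sg ar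

/-- One deduction step modulo the equational theory generated by `A`. -/
def DedStep (L : Set (Rule Sg ar)) (A : Tm Sg ar → Tm Sg ar → Prop)
    (E F : Set (Tm Sg ar)) : Prop :=
  ∃ l r σ r', (l, r) ∈ L ∧ (∀ u ∈ l, ∃ u' ∈ E, EqTh A (subst σ u) u') ∧
    EqTh A (subst σ r) r' ∧ F = E ∪ {r'}

/-- `t` is derivable from `E` modulo `A`. -/
def Deriv (L : Set (Rule Sg ar)) (A : Tm Sg ar → Tm Sg ar → Prop)
    (E : Set (Tm Sg ar)) (t : Tm Sg ar) : Prop :=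
  ∃ F, Relation.ReflTransGen (DedStep L A) E F ∧ t ∈ F

/-- One deduction step modulo the empty equational theory. -/
def DedStepSyn (L : Set (Rule Sg ar)) (E F : Set (Tm Sg ar)) : Prop :=
  ∃ l r σ, (l, r) ∈ L ∧ (∀ u ∈ l, subst σ u ∈ E) ∧ F = E ∪ {subst σ r}

/-- `t` is derivable from `E` modulo the empty theory. -/
def DerivSyn (L : Set (Rule Sg ar)) (E : Set (Tm Sg ar)) (t : Tm Sg ar) : Prop :=
  ∃ F, Relation.ReflTransGen (DedStepSyn L) E F ∧ t ∈ F

/-! ### Constraint systems -/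

/-- A constraint system with variable right-hand sides: a sequence of pairs
`(E_i, v_i)` of a finite knowledge set and a variable. -/
abbrev CSys (Sg : Type) (ar : Sg → ℕ) := List (List (Tm Sg ar) × ℕ)

/-- A general (extended) constraint system: deduction constraints `E_i ▷ t_i`. -/
abbrev GCS (Sg : Type) (ar : Sg → ℕ) := List (List (Tm Sg ar) × Tm Sg ar)

/-- The set of instances by `σ` of the members of `E`. -/
def substList (σ : Subst Sg ar) (E : List (Tm Sg ar)) : Set (Tm Sg ar) :=
  {u | ∃ e ∈ E, u = subst σ e}

/-- Well-formedness of a constraint system `((E_i ▷ v_i))_i`: knowledge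
monotonicity and origination of variables. -/
def WFC (C : CSys Sg ar) : Prop :=
  (∀ i j (hi : i < C.length) (hj : j < C.length), i ≤ j →
     ∀ u ∈ (C.get ⟨i, hi⟩).1, u ∈ (C.get ⟨j, hj⟩).1) ∧
  (∀ i (hi : i < C.length), ∀ u ∈ (C.get ⟨i, hi⟩).1, ∀ x ∈ vars u,
     ∃ j, ∃ hj : j < C.length, j < i ∧ (C.get ⟨j, hj⟩).2 = x)

/-- Well-formedness of a general constraint system `((E_i ▷ t_i))_i`. -/
def WFG (C : GCS Sg ar) : Prop :=
  (∀ i j (hi : i < C.length) (hj : j < C.length), i ≤ j →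
     ∀ u ∈ (C.get ⟨i, hi⟩).1, u ∈ (C.get ⟨j, hj⟩).1) ∧
  (∀ i (hi : i < C.length), ∀ u ∈ (C.get ⟨i, hi⟩).1, ∀ x ∈ vars u,
     ∃ j, ∃ hj : j < C.length, j < i ∧ (C.get ⟨j, hj⟩).2 = Tm.var x)

/-- `σ` satisfies the constraint system `(C, S)` in the intruder system given by
deduction rules `L` modulo the theory generated by `A`. -/
def SatC (L : Set (Rule Sg ar)) (A : Tm Sg ar → Tm Sg ar → Prop)
    (σ : Subst Sg ar) (C : CSys Sg ar) (S : List (Tm Sg ar × Tm Sg ar)) : Prop :=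
  (∀ p ∈ C, Deriv L A (substList σ p.1) (σ p.2)) ∧ HUnifier A σ S

/-- `σ` satisfies the deduction constraints of `C` modulo `A`. -/
def SatG (L : Set (Rule Sg ar)) (A : Tm Sg ar → Tm Sg ar → Prop)
    (σ : Subst Sg ar) (C : GCS Sg ar) : Prop :=
  ∀ p ∈ C, Deriv L A (substList σ p.1) (subst σ p.2)

/-- `σ` satisfies the deduction constraints of `C` modulo the empty theory. -/
def SatGSyn (L : Set (Rule Sg ar)) (σ : Subst Sg ar) (C : GCS Sg ar) : Prop :=
  ∀ p ∈ C, DerivSyn L (substList σ p.1) (subst σ p.2)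

/-- A general constraint system is in solved form when every right-hand side is
a variable. -/
def SolvedForm (C : GCS Sg ar) : Prop := ∀ p ∈ C, isVar p.2

/-- Viewing a constraint system with variable right-hand sides as a general one. -/
def toGCS (C : CSys Sg ar) : GCS Sg ar := C.map (fun p => (p.1, Tm.var p.2))

/-- Componentwise basic narrowing of lists of terms. -/
def ListNarrow (R : Tm Sg ar → Tm Sg ar → Prop) (E E' : List (Tm Sg ar)) : Prop :=
  E.length = E'.length ∧
  ∀ i (h : i < E.length) (h' : i < E'.length),
    ∃ μ, BNTerms R (E.get ⟨i, h⟩) μ (E'.get ⟨i, h'⟩)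

/-- `C'` is obtained from `C` by applying basic narrowing steps to the
subterms of `C`. -/
def CNarrow (R : Tm Sg ar → Tm Sg ar → Prop) (C C' : GCS Sg ar) : Prop :=
  C.length = C'.length ∧
  ∀ i (h : i < C.length) (h' : i < C'.length),
    ListNarrow R (C.get ⟨i, h⟩).1 (C'.get ⟨i, h'⟩).1 ∧
    ∃ μ, BNTerms R (C.get ⟨i, h⟩).2 μ (C'.get ⟨i, h'⟩).2

/-! ### Saturation -/

/-- Rule `ρ` is subsumed by a rule of `L`. -/
def Subsumed (L : Set (Rule Sg ar)) (ρ : Rule Sg ar) : Prop :=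
  ∃ l1, (l1, ρ.2) ∈ L ∧ l1 ⊆ ρ.1

/-- One narrowing step on a deduction rule `(l, r)`, performed on the
conclusion or on one of the premises, instantiating the rest. -/
def RuleNarrow (R : Tm Sg ar → Tm Sg ar → Prop) (ρ ρ' : Rule Sg ar) : Prop :=
  (∃ σ r', Narrow R ρ.2 σ r' ∧ ρ' = ((subst σ) '' ρ.1, r')) ∨
  (∃ u ∈ ρ.1, ∃ σ u', Narrow R u σ u' ∧
      ρ' = (insert u' ((subst σ) '' (ρ.1 \ {u})), subst σ ρ.2))

/-- The saturation rules of Figure 1: Subsumption, Closure and Narrow. -/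
inductive SatStep (R : Tm Sg ar → Tm Sg ar → Prop) :
    Set (Rule Sg ar) → Set (Rule Sg ar) → Prop where
  | subsum : ∀ {L : Set (Rule Sg ar)} {l1 l2 : Set (Tm Sg ar)} {r : Tm Sg ar},
      (l1, r) ∈ L → (l2, r) ∈ L → l1 ⊆ l2 → l1 ≠ l2 → SatStep R L (L \ {(l2, r)})
  | closure : ∀ {L : Set (Rule Sg ar)} {l1 l2 : Set (Tm Sg ar)}
      {r1 t r2 : Tm Sg ar} {σ : Subst Sg ar},
      (l1, r1) ∈ L → (insert t l2, r2) ∈ L → ¬ isVar t → IsMGU σ r1 t →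
      SatStep R L (insert ((subst σ) '' (l1 ∪ l2), subst σ r2) L)
  | narrow : ∀ {L : Set (Rule Sg ar)} {ρ ρ' : Rule Sg ar},
      ρ ∈ L → RuleNarrow R ρ ρ' → SatStep R L (insert ρ' L)

/-- `L` is saturated: every rule produced by Closure or Narrow is subsumed. -/
def Saturated (R : Tm Sg ar → Tm Sg ar → Prop) (L : Set (Rule Sg ar)) : Prop :=
  (∀ (l1 l2 : Set (Tm Sg ar)) (r1 t r2 : Tm Sg ar) (σ : Subst Sg ar),
     (l1, r1) ∈ L → (insert t l2, r2) ∈ L → ¬ isVar t → IsMGU σ r1 t →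
     Subsumed L ((subst σ) '' (l1 ∪ l2), subst σ r2)) ∧
  (∀ ρ ∈ L, ∀ ρ', RuleNarrow R ρ ρ' → Subsumed L ρ')

/-! ### Transformation rules on constraint systems (Figure 2) -/

/-- Instantiation of a constraint system. -/
def csubst (σ : Subst Sg ar) (C : GCS Sg ar) : GCS Sg ar :=
  C.map (fun p => (p.1.map (subst σ), subst σ p.2))

/-- The transformation rules `Unif` and `Apply` of Figure 2, applied to the
first deduction constraint whose right-hand side is not a variable. -/
inductive TStep (L' : Set (Rule Sg ar)) : GCS Sg ar → GCS Sg ar → Prop where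
  | unif : ∀ {Cα Cβ : GCS Sg ar} {E : List (Tm Sg ar)} {t u : Tm Sg ar} {σ : Subst Sg ar},
      SolvedForm Cα → ¬ isVar t → u ∈ E → ¬ isVar u → IsMGU σ u t →
      TStep L' (Cα ++ (E, t) :: Cβ) (csubst σ (Cα ++ Cβ))
  | apply : ∀ {Cα Cβ : GCS Sg ar} {E : List (Tm Sg ar)} {t r : Tm Sg ar}
      {l : Set (Tm Sg ar)} {lx lnl el : List (Tm Sg ar)} {σ : Subst Sg ar},
      SolvedForm Cα → ¬ isVar t → (l, r) ∈ L' →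
      (∀ u ∈ lx, isVar u) → (∀ u, u ∈ l ↔ (u ∈ lx ∨ u ∈ lnl)) →
      el.length = lnl.length → (∀ e ∈ el, e ∈ E) →
      IsMGUSys σ ((el.zip lnl) ++ [(r, t)]) →
      TStep L' (Cα ++ (E, t) :: Cβ)
        (csubst σ (Cα ++ (lx.map (fun y => (E, y))) ++ Cβ))

/-! ### Narrowing of unification systems (for Hullot's procedure) -/

/-- An equation between two basic-narrowing configurations. -/
abbrev EqConf (Sg : Type) (ar : Sg → ℕ) := Conf Sg ar × Conf Sg ar

def csub (σ : Subst Sg ar) (e : EqConf Sg ar) : EqConf Sg ar :=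
  ((subst σ e.1.1, e.1.2), (subst σ e.2.1, e.2.2))

/-- One basic narrowing step on one side of one equation of the system, the
substitution being applied to the whole system. -/
def SysBNStep (R : Tm Sg ar → Tm Sg ar → Prop) (c : List (EqConf Sg ar))
    (σ : Subst Sg ar) (c' : List (EqConf Sg ar)) : Prop :=
  ∃ (i : Fin c.length) (side : Bool) (d : Conf Sg ar),
    BNStep R (if side then (c.get i).1 else (c.get i).2) σ d ∧
    c' = (c.map (csub σ)).set i.1
      (if side then (d, (csub σ (c.get i)).2) else ((csub σ (c.get i)).1, d))

/-- Sequences of basic narrowing steps on a unification system, recording the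
composed substitution. -/
inductive SysBN (R : Tm Sg ar → Tm Sg ar → Prop) :
    List (EqConf Sg ar) → Subst Sg ar → List (EqConf Sg ar) → Prop where
  | refl : ∀ c, SysBN R c Tm.var c
  | step : ∀ {c c' c'' : List (EqConf Sg ar)} {σ θ : Subst Sg ar},
      SysBNStep R c σ c' → SysBN R c' θ c'' → SysBN R c (scomp θ σ) c''

/-- The initial configuration of a unification system: all non-variable
positions are basic. -/
def initConf (S : List (Tm Sg ar × Tm Sg ar)) : List (EqConf Sg ar) :=
  S.map (fun e => ((e.1, nonVarPos e.1), (e.2, nonVarPos e.2)))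

/-- The substitutions output by Hullot's procedure on the system `S`: a basic
narrowing derivation followed by syntactic unification of the resulting system. -/
def ProcOutput (R : Tm Sg ar → Tm Sg ar → Prop) (S : List (Tm Sg ar × Tm Sg ar))
    (δ : Subst Sg ar) : Prop :=
  ∃ c' σ τ, SysBN R (initConf S) σ c' ∧
    IsMGUSys τ (c'.map (fun e => (e.1.1, e.2.1))) ∧ δ = scomp τ σ

/-- The size of a unification system. -/
def sysSize (S : List (Tm Sg ar × Tm Sg ar)) : ℕ :=
  (S.map (fun e => tmSize e.1 + tmSize e.2)).sum

/-- The size of a certificate (a substitution presented as a finite list). -/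
def certSize (c : List (ℕ × Tm Sg ar)) : ℕ := (c.map (fun e => tmSize e.2)).sum

/-! ### The DSKS signature -/

/-- The signature G_DSKS = {Sig, Ver, SK', PK', 0, 1, SK, PK}. -/
inductive SgD : Type | sig | ver | skp | pkp | zero | one | sk | pk

def arD : SgD → ℕ
  | .sig => 2 | .ver => 3 | .skp => 2 | .pkp => 2
  | .zero => 0 | .one => 0 | .sk => 1 | .pk => 1

abbrev TmD := Tm SgD arD

def dSig (a b : TmD) : TmD := .app .sig ![a, b]
def dVer (a b c : TmD) : TmD := .app .ver ![a, b, c]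
def dSkp (a b : TmD) : TmD := .app .skp ![a, b]
def dPkp (a b : TmD) : TmD := .app .pkp ![a, b]
def dSk (a : TmD) : TmD := .app .sk ![a]
def dPk (a : TmD) : TmD := .app .pk ![a]
def dZero : TmD := .app .zero ![]
def dOne : TmD := .app .one ![]

def xD : TmD := .var 0
def yD : TmD := .var 1
def zD : TmD := .var 2
def y1D : TmD := .var 1
def y2D : TmD := .var 2

/-- The convergent rewrite system R_DSKS. -/
inductive RDSKS : TmD → TmD → Prop where
  | r1 : RDSKS (dVer xD (dSig xD (dSk yD)) (dPk yD)) dOne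
  | r2 : RDSKS (dVer xD (dSig xD (dSkp y1D y2D)) (dPkp y1D y2D)) dOne
  | r3 : RDSKS (dVer xD (dSig xD (dSk yD)) (dPkp (dPk yD) (dSig xD (dSk yD)))) dOne
  | r4 : RDSKS (dSig xD (dSkp (dPk yD) (dSig xD (dSk yD)))) (dSig xD (dSk yD))

/-- The axioms A_DSKS presenting the equational theory H_DSKS. -/
inductive ADSKS : TmD → TmD → Prop where
  | a1 : ADSKS (dVer xD (dSig xD (dSk yD)) (dPk yD)) dOne
  | a2 : ADSKS (dVer xD (dSig xD (dSkp y1D y2D)) (dPkp y1D y2D)) dOne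
  | a3 : ADSKS (dSig xD (dSkp (dPk yD) (dSig xD (dSk yD)))) (dSig xD (dSk yD))

/-- The intruder deduction rules L_DSKS. -/
def LDSKS : Set (Rule SgD arD) :=
  { (({xD, yD} : Set TmD), dSig xD yD), (({xD, yD, zD} : Set TmD), dVer xD yD zD),
    (({xD, yD} : Set TmD), dSkp xD yD), (({xD, yD} : Set TmD), dPkp xD yD),
    ((∅ : Set TmD), dZero), ((∅ : Set TmD), dOne) }

/-- The saturated deduction rules L'_DSKS. -/
def LDSKS' : Set (Rule SgD arD) :=
  LDSKS ∪ { (({xD, dSk yD} : Set TmD), dSig xD (dSk yD)),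
            (({xD, dSkp (dPk yD) (dSig xD (dSk yD))} : Set TmD), dSig xD (dSk yD)) }

/-! ### The DEO signature -/

/-- The signature G_DEO = {Sig, Ver, SK'', PK'', f, 0, 1, SK, PK}. -/
inductive SgE : Type | sig | ver | skp | pkp | f | zero | one | sk | pk

def arE : SgE → ℕ
  | .sig => 2 | .ver => 3 | .skp => 2 | .pkp => 2 | .f => 2
  | .zero => 0 | .one => 0 | .sk => 1 | .pk => 1

abbrev TmE := Tm SgE arE

def eSig (a b : TmE) : TmE := .app .sig ![a, b]
def eVer (a b c : TmE) : TmE := .app .ver ![a, b, c]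
def eSkp (a b : TmE) : TmE := .app .skp ![a, b]
def ePkp (a b : TmE) : TmE := .app .pkp ![a, b]
def eF (a b : TmE) : TmE := .app .f ![a, b]
def eSk (a : TmE) : TmE := .app .sk ![a]
def ePk (a : TmE) : TmE := .app .pk ![a]
def eZero : TmE := .app .zero ![]
def eOne : TmE := .app .one ![]

def xE : TmE := .var 0
def yE : TmE := .var 1
def zE : TmE := .var 2
def y1E : TmE := .var 1
def y2E : TmE := .var 2

/-- The convergent rewrite system R_DEO. -/
inductive RDEO : TmE → TmE → Prop where
  | r1 : RDEO (eVer xE (eSig xE (eSk yE)) (ePk yE)) eOne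
  | r2 : RDEO (eVer xE (eSig xE (eSkp y1E y2E)) (ePkp y1E y2E)) eOne
  | r3 : RDEO (eVer (eF (ePk yE) (eSig xE (eSk yE))) (eSig xE (eSk yE))
      (ePkp (ePk yE) (eSig xE (eSk yE)))) eOne
  | r4 : RDEO (eSig (eF (ePk yE) (eSig xE (eSk yE))) (eSkp (ePk yE) (eSig xE (eSk yE))))
      (eSig xE (eSk yE))

/-- The axioms A_DEO presenting the equational theory H_DEO. -/
inductive ADEO : TmE → TmE → Prop where
  | a1 : ADEO (eVer xE (eSig xE (eSk yE)) (ePk yE)) eOne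
  | a2 : ADEO (eVer xE (eSig xE (eSkp y1E y2E)) (ePkp y1E y2E)) eOne
  | a3 : ADEO (eSig (eF (ePk yE) (eSig xE (eSk yE))) (eSkp (ePk yE) (eSig xE (eSk yE))))
      (eSig xE (eSk yE))

/-- The intruder deduction rules L_DEO. -/
def LDEO : Set (Rule SgE arE) :=
  { (({xE, yE} : Set TmE), eSig xE yE), (({xE, yE, zE} : Set TmE), eVer xE yE zE),
    (({xE, yE} : Set TmE), eSkp xE yE), (({xE, yE} : Set TmE), ePkp xE yE),
    (({xE, yE} : Set TmE), eF xE yE),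
    ((∅ : Set TmE), eZero), ((∅ : Set TmE), eOne) }

/-- The saturated deduction rules L'_DEO. -/
def LDEO' : Set (Rule SgE arE) :=
  LDEO ∪ { (({eF (ePk yE) (eSig xE (eSk yE)), eSkp (ePk yE) (eSig xE (eSk yE))} : Set TmE),
            eSig xE (eSk yE)) }


end Paper

namespace Paper

section Normalisation

variable {Sg : Type} {ar : Sg → ℕ}

/-- Rewriting at the root. -/
def RootRew (R : Tm Sg ar → Tm Sg ar → Prop) (t u : Tm Sg ar) : Prop :=
  ∃ l r σ, R l r ∧ t = subst σ l ∧ u = subst σ r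

open Classical in
/-- Contraction of the redex at the root, if there is one. -/
noncomputable def contract (R : Tm Sg ar → Tm Sg ar → Prop) (t : Tm Sg ar) : Tm Sg ar :=
  if h : ∃ u, RootRew R t u then h.choose else t

/-- Innermost normalisation, contracting each root at most once. -/
noncomputable def normalise (R : Tm Sg ar → Tm Sg ar → Prop) : Tm Sg ar → Tm Sg ar
  | .var n => .var n
  | .cst c => .cst c
  | .app s a => contract R (.app s (fun i => normalise R (a i)))

variable {R : Tm Sg ar → Tm Sg ar → Prop}

theorem contract_eq_self_or_rootRew (t : Tm Sg ar) :
    contract R t = t ∨ RootRew R t (contract R t) := by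
  unfold contract
  split_ifs with h
  · exact .inr h.choose_spec
  · exact .inl rfl

theorem contract_eq_self {t : Tm Sg ar} (h : ∀ u, ¬ RootRew R t u) : contract R t = t :=
  (contract_eq_self_or_rootRew t).resolve_right (h _)

theorem contract_eq_of_rootRew (hR : Relator.RightUnique (RootRew R)) {t u : Tm Sg ar}
    (h : RootRew R t u) : contract R t = u := by
  have hex : ∃ u, RootRew R t u := ⟨u, h⟩
  rw [contract, dif_pos hex]
  exact hR hex.choose_spec h

theorem NormalForm.normalise_eq {t : Tm Sg ar} (h : NormalForm R t) : normalise R t = t := by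
  induction t with
  | var n => rfl
  | cst c => rfl
  | app s a ih =>
    have harg : (fun i => normalise R (a i)) = a := by
      classical
      funext i
      refine ih i fun u hu => h (.app s (Function.update a i u)) ?_
      refine Rew.congr s _ _ i (by simpa using hu) fun j hj => ?_
      simp [Function.update_of_ne hj]
    rw [normalise, harg]
    refine contract_eq_self ?_
    rintro u ⟨l, r, σ, hlr, ht, -⟩
    exact h (subst σ r) (ht ▸ Rew.root l r σ hlr)

theorem EqTh.normalise_eq {A : Tm Sg ar → Tm Sg ar → Prop}
    (hA : ∀ l r σ, A l r → normalise R (subst σ l) = normalise R (subst σ r))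
    {t u : Tm Sg ar} (h : EqTh A t u) : normalise R t = normalise R u := by
  induction h with
  | ax l r σ hlr => exact hA l r σ hlr
  | refl t => rfl
  | symm _ ih => exact ih.symm
  | trans _ _ ih₁ ih₂ => exact ih₁.trans ih₂
  | congr s a b _ ih => simp only [normalise, ih]

theorem DerivSyn.deriv {L : Set (Rule Sg ar)} {A : Tm Sg ar → Tm Sg ar → Prop}
    {E : Set (Tm Sg ar)} {t : Tm Sg ar} (h : DerivSyn L E t) : Deriv L A E t := by
  obtain ⟨F, hF, ht⟩ := h
  refine ⟨F, Relation.ReflTransGen.mono ?_ _ _ hF, ht⟩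
  rintro E F ⟨l, r, σ, hlr, hl, rfl⟩
  exact ⟨l, r, σ, _, hlr, fun u hu => ⟨_, hl u hu, .refl _⟩, .refl _, rfl⟩

/-- If normalising the instances of a deduction rule always gives an instance of a deduction
rule, then derivations can be normalised step by step. -/
theorem Deriv.derivSyn {L : Set (Rule Sg ar)} {A : Tm Sg ar → Tm Sg ar → Prop}
    (hA : ∀ l r σ, A l r → normalise R (subst σ l) = normalise R (subst σ r))
    (hL : ∀ l r σ, (l, r) ∈ L → ∃ l' r' τ, (l', r') ∈ L ∧
      (∀ u ∈ l', ∃ v ∈ l, subst τ u = normalise R (subst σ v)) ∧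
      subst τ r' = normalise R (subst σ r))
    {E : Set (Tm Sg ar)} {t : Tm Sg ar} (hE : ∀ u ∈ E, NormalForm R u) (ht : NormalForm R t)
    (h : Deriv L A E t) : DerivSyn L E t := by
  obtain ⟨F, hF, htF⟩ := h
  suffices ∃ F', Relation.ReflTransGen (DedStepSyn L) E F' ∧ ∀ u ∈ F, normalise R u ∈ F' by
    obtain ⟨F', hF', hsub⟩ := this
    exact ⟨F', hF', ht.normalise_eq ▸ hsub t htF⟩
  clear htF
  induction hF with
  | refl => exact ⟨E, .refl, fun u hu => by rwa [(hE u hu).normalise_eq]⟩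
  | tail _ hstep ih =>
    obtain ⟨F', hF', hsub⟩ := ih
    obtain ⟨l, r, σ, w, hlr, hl, hw, rfl⟩ := hstep
    obtain ⟨l', r', τ, hlr', hl', hr'⟩ := hL l r σ hlr
    refine ⟨F' ∪ {subst τ r'}, hF'.tail ⟨l', r', τ, hlr', fun u hu => ?_, rfl⟩, ?_⟩
    · obtain ⟨v, hv, huv⟩ := hl' u hu
      obtain ⟨v', hv', hvv'⟩ := hl v hv
      rw [huv, hvv'.normalise_eq hA]
      exact hsub v' hv'
    · rintro u (hu | rfl)
      · exact .inl (hsub u hu)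
      · exact .inr (by rw [Set.mem_singleton_iff, hr', hw.normalise_eq hA])

end Normalisation

section DSKS

@[simp] theorem dSig_inj {a b a' b' : TmD} :
    dSig a b = dSig a' b' ↔ a = a' ∧ b = b' := by
  refine ⟨fun h => ?_, by rintro ⟨rfl, rfl⟩; rfl⟩
  have h := eq_of_heq (Tm.app.inj h).2
  exact ⟨congrFun h 0, congrFun h 1⟩

@[simp] theorem dSkp_inj {a b a' b' : TmD} :
    dSkp a b = dSkp a' b' ↔ a = a' ∧ b = b' := by
  refine ⟨fun h => ?_, by rintro ⟨rfl, rfl⟩; rfl⟩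
  have h := eq_of_heq (Tm.app.inj h).2
  exact ⟨congrFun h 0, congrFun h 1⟩

@[simp] theorem dPk_inj {a a' : TmD} :
    dPk a = dPk a' ↔ a = a' := by
  refine ⟨fun h => ?_, by rintro rfl; rfl⟩
  have h := eq_of_heq (Tm.app.inj h).2
  exact congrFun h 0

@[simp] theorem subst_dSig (σ : ℕ → TmD) (a b : TmD) :
    subst σ (dSig a b) = dSig (subst σ a) (subst σ b) := by
  refine congrArg (Tm.app _) (funext fun i => ?_)
  fin_cases i <;> rfl

@[simp] theorem subst_dVer (σ : ℕ → TmD) (a b c : TmD) :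
    subst σ (dVer a b c) = dVer (subst σ a) (subst σ b) (subst σ c) := by
  refine congrArg (Tm.app _) (funext fun i => ?_)
  fin_cases i <;> rfl

@[simp] theorem subst_dSkp (σ : ℕ → TmD) (a b : TmD) :
    subst σ (dSkp a b) = dSkp (subst σ a) (subst σ b) := by
  refine congrArg (Tm.app _) (funext fun i => ?_)
  fin_cases i <;> rfl

@[simp] theorem subst_dPkp (σ : ℕ → TmD) (a b : TmD) :
    subst σ (dPkp a b) = dPkp (subst σ a) (subst σ b) := by
  refine congrArg (Tm.app _) (funext fun i => ?_)
  fin_cases i <;> rfl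

@[simp] theorem subst_dSk (σ : ℕ → TmD) (a : TmD) :
    subst σ (dSk a) = dSk (subst σ a) := by
  refine congrArg (Tm.app _) (funext fun i => ?_)
  fin_cases i; rfl

@[simp] theorem subst_dPk (σ : ℕ → TmD) (a : TmD) :
    subst σ (dPk a) = dPk (subst σ a) := by
  refine congrArg (Tm.app _) (funext fun i => ?_)
  fin_cases i; rfl

@[simp] theorem subst_dZero (σ : ℕ → TmD) :
    subst σ dZero = dZero := by
  refine congrArg (Tm.app _) (funext fun i => ?_)
  exact i.elim0

@[simp] theorem subst_dOne (σ : ℕ → TmD) :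
    subst σ dOne = dOne := by
  refine congrArg (Tm.app _) (funext fun i => ?_)
  exact i.elim0

@[simp] theorem normalise_dSig (a b : TmD) :
    normalise RDSKS (dSig a b) =
      contract RDSKS (dSig (normalise RDSKS a) (normalise RDSKS b)) := by
  simp only [dSig, normalise]
  congr 2
  funext i
  fin_cases i <;> rfl

@[simp] theorem normalise_dVer (a b c : TmD) :
    normalise RDSKS (dVer a b c) =
      contract RDSKS (dVer (normalise RDSKS a) (normalise RDSKS b) (normalise RDSKS c)) := by
  simp only [dVer, normalise]
  congr 2
  funext i
  fin_cases i <;> rfl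

@[simp] theorem normalise_dSkp (a b : TmD) :
    normalise RDSKS (dSkp a b) =
      contract RDSKS (dSkp (normalise RDSKS a) (normalise RDSKS b)) := by
  simp only [dSkp, normalise]
  congr 2
  funext i
  fin_cases i <;> rfl

@[simp] theorem normalise_dPkp (a b : TmD) :
    normalise RDSKS (dPkp a b) =
      contract RDSKS (dPkp (normalise RDSKS a) (normalise RDSKS b)) := by
  simp only [dPkp, normalise]
  congr 2
  funext i
  fin_cases i <;> rfl

@[simp] theorem normalise_dSk (a : TmD) :
    normalise RDSKS (dSk a) =
      contract RDSKS (dSk (normalise RDSKS a)) := by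
  simp only [dSk, normalise]
  congr 2
  funext i
  fin_cases i; rfl

@[simp] theorem normalise_dPk (a : TmD) :
    normalise RDSKS (dPk a) =
      contract RDSKS (dPk (normalise RDSKS a)) := by
  simp only [dPk, normalise]
  congr 2
  funext i
  fin_cases i; rfl

@[simp] theorem normalise_dZero :
    normalise RDSKS dZero =
      contract RDSKS dZero := by
  simp only [dZero, normalise]
  congr 2
  funext i
  exact i.elim0

@[simp] theorem normalise_dOne :
    normalise RDSKS dOne =
      contract RDSKS dOne := by
  simp only [dOne, normalise]
  congr 2
  funext i
  exact i.elim0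

@[simp] theorem subst_xD (σ : ℕ → TmD) : subst σ xD = σ 0 := rfl

@[simp] theorem subst_yD (σ : ℕ → TmD) : subst σ yD = σ 1 := rfl

@[simp] theorem subst_zD (σ : ℕ → TmD) : subst σ zD = σ 2 := rfl

@[simp] theorem subst_y1D (σ : ℕ → TmD) : subst σ y1D = σ 1 := rfl

@[simp] theorem subst_y2D (σ : ℕ → TmD) : subst σ y2D = σ 2 := rfl

theorem rootRew_RDSKS_iff {t u : TmD} : RootRew RDSKS t u ↔
    ((∃ x y, t = dVer x (dSig x (dSk y)) (dPk y)) ∧ u = dOne) ∨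
    ((∃ x y z, t = dVer x (dSig x (dSkp y z)) (dPkp y z)) ∧ u = dOne) ∨
    ((∃ x y, t = dVer x (dSig x (dSk y))
      (dPkp (dPk y) (dSig x (dSk y)))) ∧
      u = dOne) ∨
    (∃ x y, t = dSig x (dSkp (dPk y) (dSig x (dSk y))) ∧
      u = dSig x (dSk y)) := by
  constructor
  · rintro ⟨l, r, σ, h, rfl, rfl⟩
    cases h
    · exact .inl ⟨⟨σ 0, σ 1, by simp⟩, by simp⟩
    · exact .inr (.inl ⟨⟨σ 0, σ 1, σ 2, by simp⟩, by simp⟩)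
    · exact .inr (.inr (.inl ⟨⟨σ 0, σ 1, by simp⟩, by simp⟩))
    · exact .inr (.inr (.inr ⟨σ 0, σ 1, by simp, by simp⟩))
  · rintro (⟨⟨x, y, rfl⟩, rfl⟩ | ⟨⟨x, y, z, rfl⟩, rfl⟩ | ⟨⟨x, y, rfl⟩, rfl⟩ | ⟨x, y, rfl, rfl⟩)
    · refine ⟨_, _, fun n => if n = 0 then x else y, .r1, by simp, by simp⟩
    · refine ⟨_, _, fun n => if n = 0 then x else if n = 1 then y else z, .r2, by simp, by simp⟩
    · refine ⟨_, _, fun n => if n = 0 then x else y, .r3, by simp, by simp⟩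
    · refine ⟨_, _, fun n => if n = 0 then x else y, .r4, by simp, by simp⟩

theorem dSig_ne_dVer (a b c d e : TmD) : dSig a b ≠ dVer c d e :=
  fun h => absurd (Tm.app.inj h).1 nofun

theorem rightUnique_rootRew_RDSKS : Relator.RightUnique (RootRew RDSKS) := by
  intro t u v hu hv
  rw [rootRew_RDSKS_iff] at hu hv
  rcases hu with ⟨⟨x, y, rfl⟩, rfl⟩ | ⟨⟨x, y, z, rfl⟩, rfl⟩ | ⟨⟨x, y, rfl⟩, rfl⟩ | ⟨x, y, rfl, rfl⟩
  iterate 3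
    rcases hv with ⟨-, rfl⟩ | ⟨-, rfl⟩ | ⟨-, rfl⟩ | ⟨_, _, h, -⟩
    iterate 3 rfl
    exact absurd h.symm (dSig_ne_dVer _ _ _ _ _)
  rcases hv with ⟨⟨_, _, h⟩, -⟩ | ⟨⟨_, _, _, h⟩, -⟩ | ⟨⟨_, _, h⟩, -⟩ | ⟨_, _, h, rfl⟩
  iterate 3 exact absurd h (dSig_ne_dVer _ _ _ _ _)
  simp only [dSig_inj, dSkp_inj, dPk_inj] at h
  grind

theorem contract_RDSKS_app_eq_self {s : SgD} (hs : s ≠ .sig) (hv : s ≠ .ver)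
    (a : Fin (arD s) → TmD) : contract RDSKS (.app s a) = .app s a :=
  contract_eq_self fun u hu => by
    rw [rootRew_RDSKS_iff] at hu
    rcases hu with ⟨⟨_, _, h⟩, -⟩ | ⟨⟨_, _, _, h⟩, -⟩ | ⟨⟨_, _, h⟩, -⟩ | ⟨_, _, h, -⟩
    iterate 3 exact hv (Tm.app.inj h).1
    exact hs (Tm.app.inj h).1

@[simp] theorem contract_dSkp (a b : TmD) : contract RDSKS (dSkp a b) = dSkp a b :=
  contract_RDSKS_app_eq_self (s := .skp) nofun nofun _

@[simp] theorem contract_dPkp (a b : TmD) : contract RDSKS (dPkp a b) = dPkp a b :=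
  contract_RDSKS_app_eq_self (s := .pkp) nofun nofun _

@[simp] theorem contract_dSk (a : TmD) : contract RDSKS (dSk a) = dSk a :=
  contract_RDSKS_app_eq_self (s := .sk) nofun nofun _

@[simp] theorem contract_dPk (a : TmD) : contract RDSKS (dPk a) = dPk a :=
  contract_RDSKS_app_eq_self (s := .pk) nofun nofun _

@[simp] theorem contract_dZero : contract RDSKS dZero = dZero :=
  contract_RDSKS_app_eq_self (s := .zero) nofun nofun _

@[simp] theorem contract_dOne : contract RDSKS dOne = dOne :=
  contract_RDSKS_app_eq_self (s := .one) nofun nofun _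

@[simp] theorem contract_dSig_dSk (x y : TmD) : contract RDSKS (dSig x (dSk y)) = dSig x (dSk y) :=
  contract_eq_self fun u hu => by
    rw [rootRew_RDSKS_iff] at hu
    rcases hu with ⟨⟨_, _, h⟩, -⟩ | ⟨⟨_, _, _, h⟩, -⟩ | ⟨⟨_, _, h⟩, -⟩ | ⟨_, _, h, -⟩
    iterate 3 exact dSig_ne_dVer _ _ _ _ _ h
    exact absurd (Tm.app.inj (dSig_inj.1 h).2).1 nofun

@[simp] theorem contract_dSig_dSkp (x y : TmD) :
    contract RDSKS (dSig x (dSkp (dPk y) (dSig x (dSk y)))) =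
      dSig x (dSk y) :=
  contract_eq_of_rootRew rightUnique_rootRew_RDSKS
    (rootRew_RDSKS_iff.2 (.inr (.inr (.inr ⟨x, y, rfl, rfl⟩))))

theorem contract_dSig_eq_self_or (a b : TmD) : contract RDSKS (dSig a b) = dSig a b ∨
    ∃ x y, a = x ∧ b = dSkp (dPk y) (dSig x (dSk y)) ∧
      contract RDSKS (dSig a b) = dSig x (dSk y) := by
  refine (contract_eq_self_or_rootRew _).imp_right fun h => ?_
  rw [rootRew_RDSKS_iff] at h
  rcases h with ⟨⟨_, _, h⟩, -⟩ | ⟨⟨_, _, _, h⟩, -⟩ | ⟨⟨_, _, h⟩, -⟩ | ⟨x, y, h, h'⟩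
  iterate 3 exact absurd h (dSig_ne_dVer _ _ _ _ _)
  exact ⟨x, y, (dSig_inj.1 h).1, (dSig_inj.1 h).2, h'⟩

@[simp] theorem contract_dVer_dPk (x y : TmD) :
    contract RDSKS (dVer x (dSig x (dSk y)) (dPk y)) = dOne :=
  contract_eq_of_rootRew rightUnique_rootRew_RDSKS
    (rootRew_RDSKS_iff.2 (.inl ⟨⟨x, y, rfl⟩, rfl⟩))

@[simp] theorem contract_dVer_dPkp (x y z : TmD) :
    contract RDSKS (dVer x (contract RDSKS (dSig x (dSkp y z))) (dPkp y z)) = dOne := by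
  refine contract_eq_of_rootRew rightUnique_rootRew_RDSKS (rootRew_RDSKS_iff.2 ?_)
  rcases contract_dSig_eq_self_or x (dSkp y z) with h | ⟨x', y', hx, h, hc⟩
  · rw [h]
    exact .inr (.inl ⟨⟨x, y, z, rfl⟩, rfl⟩)
  · obtain ⟨rfl, rfl⟩ := dSkp_inj.1 h
    subst hx
    rw [hc]
    exact .inr (.inr (.inl ⟨⟨_, _, rfl⟩, rfl⟩))

theorem contract_dVer_eq_self_or (a b c : TmD) :
    contract RDSKS (dVer a b c) = dVer a b c ∨ contract RDSKS (dVer a b c) = dOne := by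
  refine (contract_eq_self_or_rootRew _).imp_right fun h => ?_
  rw [rootRew_RDSKS_iff] at h
  rcases h with ⟨-, h⟩ | ⟨-, h⟩ | ⟨-, h⟩ | ⟨_, _, h, -⟩
  iterate 3 exact h
  exact absurd h.symm (dSig_ne_dVer _ _ _ _ _)

theorem ADSKS.normalise_eq {l r : TmD} (h : ADSKS l r) (σ : ℕ → TmD) :
    normalise RDSKS (subst σ l) = normalise RDSKS (subst σ r) := by
  cases h <;> simp

theorem exists_normalised_instance_LDSKS (l : Set TmD) (r : TmD) (σ : ℕ → TmD)
    (h : (l, r) ∈ LDSKS') : ∃ l' r' τ, (l', r') ∈ LDSKS' ∧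
      (∀ u ∈ l', ∃ v ∈ l, subst τ u = normalise RDSKS (subst σ v)) ∧
      subst τ r' = normalise RDSKS (subst σ r) := by
  have same (hl : ∀ u ∈ l, subst (fun n => normalise RDSKS (σ n)) u = normalise RDSKS (subst σ u))
      (hr : subst (fun n => normalise RDSKS (σ n)) r = normalise RDSKS (subst σ r)) :
      ∃ l' r' τ, (l', r') ∈ LDSKS' ∧
        (∀ u ∈ l', ∃ v ∈ l, subst τ u = normalise RDSKS (subst σ v)) ∧
        subst τ r' = normalise RDSKS (subst σ r) :=
    ⟨l, r, _, h, fun u hu => ⟨u, hu, hl u hu⟩, hr⟩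
  simp only [LDSKS', LDSKS, Set.mem_union, Set.mem_insert_iff, Set.mem_singleton_iff, Prod.mk.injEq,
    or_assoc] at h
  rcases h with ⟨rfl, rfl⟩ | ⟨rfl, rfl⟩ | ⟨rfl, rfl⟩ | ⟨rfl, rfl⟩ |
      ⟨rfl, rfl⟩ | ⟨rfl, rfl⟩ | ⟨rfl, rfl⟩ | ⟨rfl, rfl⟩
  · rcases contract_dSig_eq_self_or (normalise RDSKS (σ 0)) (normalise RDSKS (σ 1)) with
      hc | ⟨x, y, hx, hy, hc⟩
    · apply same <;> simp [hc]
    · refine ⟨{xD, dSkp (dPk yD) (dSig xD (dSk yD))},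
        dSig xD (dSk yD), fun n => if n = 0 then x else y,
        by simp [LDSKS'], ?_, ?_⟩
      · simp [hx, hy]
      · simp [hc]
  · rcases contract_dVer_eq_self_or (normalise RDSKS (σ 0)) (normalise RDSKS (σ 1))
      (normalise RDSKS (σ 2)) with hc | hc
    · apply same <;> simp [hc]
    · refine ⟨∅, dOne, σ, by simp [LDSKS', LDSKS], by simp, ?_⟩
      simp [hc]
  all_goals apply same <;> simp

end DSKS

section DEO

@[simp] theorem eSig_inj {a b a' b' : TmE} :
    eSig a b = eSig a' b' ↔ a = a' ∧ b = b' := by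
  refine ⟨fun h => ?_, by rintro ⟨rfl, rfl⟩; rfl⟩
  have h := eq_of_heq (Tm.app.inj h).2
  exact ⟨congrFun h 0, congrFun h 1⟩

@[simp] theorem eSkp_inj {a b a' b' : TmE} :
    eSkp a b = eSkp a' b' ↔ a = a' ∧ b = b' := by
  refine ⟨fun h => ?_, by rintro ⟨rfl, rfl⟩; rfl⟩
  have h := eq_of_heq (Tm.app.inj h).2
  exact ⟨congrFun h 0, congrFun h 1⟩

@[simp] theorem ePk_inj {a a' : TmE} :
    ePk a = ePk a' ↔ a = a' := by
  refine ⟨fun h => ?_, by rintro rfl; rfl⟩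
  have h := eq_of_heq (Tm.app.inj h).2
  exact congrFun h 0

@[simp] theorem subst_eSig (σ : ℕ → TmE) (a b : TmE) :
    subst σ (eSig a b) = eSig (subst σ a) (subst σ b) := by
  refine congrArg (Tm.app _) (funext fun i => ?_)
  fin_cases i <;> rfl

@[simp] theorem subst_eVer (σ : ℕ → TmE) (a b c : TmE) :
    subst σ (eVer a b c) = eVer (subst σ a) (subst σ b) (subst σ c) := by
  refine congrArg (Tm.app _) (funext fun i => ?_)
  fin_cases i <;> rfl

@[simp] theorem subst_eSkp (σ : ℕ → TmE) (a b : TmE) :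
    subst σ (eSkp a b) = eSkp (subst σ a) (subst σ b) := by
  refine congrArg (Tm.app _) (funext fun i => ?_)
  fin_cases i <;> rfl

@[simp] theorem subst_ePkp (σ : ℕ → TmE) (a b : TmE) :
    subst σ (ePkp a b) = ePkp (subst σ a) (subst σ b) := by
  refine congrArg (Tm.app _) (funext fun i => ?_)
  fin_cases i <;> rfl

@[simp] theorem subst_eF (σ : ℕ → TmE) (a b : TmE) :
    subst σ (eF a b) = eF (subst σ a) (subst σ b) := by
  refine congrArg (Tm.app _) (funext fun i => ?_)
  fin_cases i <;> rfl

@[simp] theorem subst_eSk (σ : ℕ → TmE) (a : TmE) :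
    subst σ (eSk a) = eSk (subst σ a) := by
  refine congrArg (Tm.app _) (funext fun i => ?_)
  fin_cases i; rfl

@[simp] theorem subst_ePk (σ : ℕ → TmE) (a : TmE) :
    subst σ (ePk a) = ePk (subst σ a) := by
  refine congrArg (Tm.app _) (funext fun i => ?_)
  fin_cases i; rfl

@[simp] theorem subst_eZero (σ : ℕ → TmE) :
    subst σ eZero = eZero := by
  refine congrArg (Tm.app _) (funext fun i => ?_)
  exact i.elim0

@[simp] theorem subst_eOne (σ : ℕ → TmE) :
    subst σ eOne = eOne := by
  refine congrArg (Tm.app _) (funext fun i => ?_)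
  exact i.elim0

@[simp] theorem normalise_eSig (a b : TmE) :
    normalise RDEO (eSig a b) =
      contract RDEO (eSig (normalise RDEO a) (normalise RDEO b)) := by
  simp only [eSig, normalise]
  congr 2
  funext i
  fin_cases i <;> rfl

@[simp] theorem normalise_eVer (a b c : TmE) :
    normalise RDEO (eVer a b c) =
      contract RDEO (eVer (normalise RDEO a) (normalise RDEO b) (normalise RDEO c)) := by
  simp only [eVer, normalise]
  congr 2
  funext i
  fin_cases i <;> rfl

@[simp] theorem normalise_eSkp (a b : TmE) :
    normalise RDEO (eSkp a b) =
      contract RDEO (eSkp (normalise RDEO a) (normalise RDEO b)) := by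
  simp only [eSkp, normalise]
  congr 2
  funext i
  fin_cases i <;> rfl

@[simp] theorem normalise_ePkp (a b : TmE) :
    normalise RDEO (ePkp a b) =
      contract RDEO (ePkp (normalise RDEO a) (normalise RDEO b)) := by
  simp only [ePkp, normalise]
  congr 2
  funext i
  fin_cases i <;> rfl

@[simp] theorem normalise_eF (a b : TmE) :
    normalise RDEO (eF a b) =
      contract RDEO (eF (normalise RDEO a) (normalise RDEO b)) := by
  simp only [eF, normalise]
  congr 2
  funext i
  fin_cases i <;> rfl

@[simp] theorem normalise_eSk (a : TmE) :
    normalise RDEO (eSk a) =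
      contract RDEO (eSk (normalise RDEO a)) := by
  simp only [eSk, normalise]
  congr 2
  funext i
  fin_cases i; rfl

@[simp] theorem normalise_ePk (a : TmE) :
    normalise RDEO (ePk a) =
      contract RDEO (ePk (normalise RDEO a)) := by
  simp only [ePk, normalise]
  congr 2
  funext i
  fin_cases i; rfl

@[simp] theorem normalise_eZero :
    normalise RDEO eZero =
      contract RDEO eZero := by
  simp only [eZero, normalise]
  congr 2
  funext i
  exact i.elim0

@[simp] theorem normalise_eOne :
    normalise RDEO eOne =
      contract RDEO eOne := by
  simp only [eOne, normalise]
  congr 2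
  funext i
  exact i.elim0

@[simp] theorem subst_xE (σ : ℕ → TmE) : subst σ xE = σ 0 := rfl

@[simp] theorem subst_yE (σ : ℕ → TmE) : subst σ yE = σ 1 := rfl

@[simp] theorem subst_zE (σ : ℕ → TmE) : subst σ zE = σ 2 := rfl

@[simp] theorem subst_y1E (σ : ℕ → TmE) : subst σ y1E = σ 1 := rfl

@[simp] theorem subst_y2E (σ : ℕ → TmE) : subst σ y2E = σ 2 := rfl

theorem rootRew_RDEO_iff {t u : TmE} : RootRew RDEO t u ↔
    ((∃ x y, t = eVer x (eSig x (eSk y)) (ePk y)) ∧ u = eOne) ∨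
    ((∃ x y z, t = eVer x (eSig x (eSkp y z)) (ePkp y z)) ∧ u = eOne) ∨
    ((∃ x y, t = eVer (eF (ePk y) (eSig x (eSk y))) (eSig x (eSk y))
      (ePkp (ePk y) (eSig x (eSk y)))) ∧
      u = eOne) ∨
    (∃ x y, t = eSig (eF (ePk y) (eSig x (eSk y))) (eSkp (ePk y) (eSig x (eSk y))) ∧
      u = eSig x (eSk y)) := by
  constructor
  · rintro ⟨l, r, σ, h, rfl, rfl⟩
    cases h
    · exact .inl ⟨⟨σ 0, σ 1, by simp⟩, by simp⟩
    · exact .inr (.inl ⟨⟨σ 0, σ 1, σ 2, by simp⟩, by simp⟩)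
    · exact .inr (.inr (.inl ⟨⟨σ 0, σ 1, by simp⟩, by simp⟩))
    · exact .inr (.inr (.inr ⟨σ 0, σ 1, by simp, by simp⟩))
  · rintro (⟨⟨x, y, rfl⟩, rfl⟩ | ⟨⟨x, y, z, rfl⟩, rfl⟩ | ⟨⟨x, y, rfl⟩, rfl⟩ | ⟨x, y, rfl, rfl⟩)
    · refine ⟨_, _, fun n => if n = 0 then x else y, .r1, by simp, by simp⟩
    · refine ⟨_, _, fun n => if n = 0 then x else if n = 1 then y else z, .r2, by simp, by simp⟩
    · refine ⟨_, _, fun n => if n = 0 then x else y, .r3, by simp, by simp⟩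
    · refine ⟨_, _, fun n => if n = 0 then x else y, .r4, by simp, by simp⟩

theorem eSig_ne_eVer (a b c d e : TmE) : eSig a b ≠ eVer c d e :=
  fun h => absurd (Tm.app.inj h).1 nofun

theorem rightUnique_rootRew_RDEO : Relator.RightUnique (RootRew RDEO) := by
  intro t u v hu hv
  rw [rootRew_RDEO_iff] at hu hv
  rcases hu with ⟨⟨x, y, rfl⟩, rfl⟩ | ⟨⟨x, y, z, rfl⟩, rfl⟩ | ⟨⟨x, y, rfl⟩, rfl⟩ | ⟨x, y, rfl, rfl⟩
  iterate 3
    rcases hv with ⟨-, rfl⟩ | ⟨-, rfl⟩ | ⟨-, rfl⟩ | ⟨_, _, h, -⟩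
    iterate 3 rfl
    exact absurd h.symm (eSig_ne_eVer _ _ _ _ _)
  rcases hv with ⟨⟨_, _, h⟩, -⟩ | ⟨⟨_, _, _, h⟩, -⟩ | ⟨⟨_, _, h⟩, -⟩ | ⟨_, _, h, rfl⟩
  iterate 3 exact absurd h (eSig_ne_eVer _ _ _ _ _)
  simp only [eSig_inj, eSkp_inj, ePk_inj] at h
  grind

theorem contract_RDEO_app_eq_self {s : SgE} (hs : s ≠ .sig) (hv : s ≠ .ver)
    (a : Fin (arE s) → TmE) : contract RDEO (.app s a) = .app s a :=
  contract_eq_self fun u hu => by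
    rw [rootRew_RDEO_iff] at hu
    rcases hu with ⟨⟨_, _, h⟩, -⟩ | ⟨⟨_, _, _, h⟩, -⟩ | ⟨⟨_, _, h⟩, -⟩ | ⟨_, _, h, -⟩
    iterate 3 exact hv (Tm.app.inj h).1
    exact hs (Tm.app.inj h).1

@[simp] theorem contract_eSkp (a b : TmE) : contract RDEO (eSkp a b) = eSkp a b :=
  contract_RDEO_app_eq_self (s := .skp) nofun nofun _

@[simp] theorem contract_ePkp (a b : TmE) : contract RDEO (ePkp a b) = ePkp a b :=
  contract_RDEO_app_eq_self (s := .pkp) nofun nofun _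

@[simp] theorem contract_eF (a b : TmE) : contract RDEO (eF a b) = eF a b :=
  contract_RDEO_app_eq_self (s := .f) nofun nofun _

@[simp] theorem contract_eSk (a : TmE) : contract RDEO (eSk a) = eSk a :=
  contract_RDEO_app_eq_self (s := .sk) nofun nofun _

@[simp] theorem contract_ePk (a : TmE) : contract RDEO (ePk a) = ePk a :=
  contract_RDEO_app_eq_self (s := .pk) nofun nofun _

@[simp] theorem contract_eZero : contract RDEO eZero = eZero :=
  contract_RDEO_app_eq_self (s := .zero) nofun nofun _

@[simp] theorem contract_eOne : contract RDEO eOne = eOne :=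
  contract_RDEO_app_eq_self (s := .one) nofun nofun _

@[simp] theorem contract_eSig_eSk (x y : TmE) : contract RDEO (eSig x (eSk y)) = eSig x (eSk y) :=
  contract_eq_self fun u hu => by
    rw [rootRew_RDEO_iff] at hu
    rcases hu with ⟨⟨_, _, h⟩, -⟩ | ⟨⟨_, _, _, h⟩, -⟩ | ⟨⟨_, _, h⟩, -⟩ | ⟨_, _, h, -⟩
    iterate 3 exact eSig_ne_eVer _ _ _ _ _ h
    exact absurd (Tm.app.inj (eSig_inj.1 h).2).1 nofun

@[simp] theorem contract_eSig_eSkp (x y : TmE) :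
    contract RDEO (eSig (eF (ePk y) (eSig x (eSk y))) (eSkp (ePk y) (eSig x (eSk y)))) =
      eSig x (eSk y) :=
  contract_eq_of_rootRew rightUnique_rootRew_RDEO
    (rootRew_RDEO_iff.2 (.inr (.inr (.inr ⟨x, y, rfl, rfl⟩))))

theorem contract_eSig_eq_self_or (a b : TmE) : contract RDEO (eSig a b) = eSig a b ∨
    ∃ x y, a = eF (ePk y) (eSig x (eSk y)) ∧ b = eSkp (ePk y) (eSig x (eSk y)) ∧
      contract RDEO (eSig a b) = eSig x (eSk y) := by
  refine (contract_eq_self_or_rootRew _).imp_right fun h => ?_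
  rw [rootRew_RDEO_iff] at h
  rcases h with ⟨⟨_, _, h⟩, -⟩ | ⟨⟨_, _, _, h⟩, -⟩ | ⟨⟨_, _, h⟩, -⟩ | ⟨x, y, h, h'⟩
  iterate 3 exact absurd h (eSig_ne_eVer _ _ _ _ _)
  exact ⟨x, y, (eSig_inj.1 h).1, (eSig_inj.1 h).2, h'⟩

@[simp] theorem contract_eVer_ePk (x y : TmE) :
    contract RDEO (eVer x (eSig x (eSk y)) (ePk y)) = eOne :=
  contract_eq_of_rootRew rightUnique_rootRew_RDEO
    (rootRew_RDEO_iff.2 (.inl ⟨⟨x, y, rfl⟩, rfl⟩))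

@[simp] theorem contract_eVer_ePkp (x y z : TmE) :
    contract RDEO (eVer x (contract RDEO (eSig x (eSkp y z))) (ePkp y z)) = eOne := by
  refine contract_eq_of_rootRew rightUnique_rootRew_RDEO (rootRew_RDEO_iff.2 ?_)
  rcases contract_eSig_eq_self_or x (eSkp y z) with h | ⟨x', y', hx, h, hc⟩
  · rw [h]
    exact .inr (.inl ⟨⟨x, y, z, rfl⟩, rfl⟩)
  · obtain ⟨rfl, rfl⟩ := eSkp_inj.1 h
    subst hx
    rw [hc]
    exact .inr (.inr (.inl ⟨⟨_, _, rfl⟩, rfl⟩))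

theorem contract_eVer_eq_self_or (a b c : TmE) :
    contract RDEO (eVer a b c) = eVer a b c ∨ contract RDEO (eVer a b c) = eOne := by
  refine (contract_eq_self_or_rootRew _).imp_right fun h => ?_
  rw [rootRew_RDEO_iff] at h
  rcases h with ⟨-, h⟩ | ⟨-, h⟩ | ⟨-, h⟩ | ⟨_, _, h, -⟩
  iterate 3 exact h
  exact absurd h.symm (eSig_ne_eVer _ _ _ _ _)

theorem ADEO.normalise_eq {l r : TmE} (h : ADEO l r) (σ : ℕ → TmE) :
    normalise RDEO (subst σ l) = normalise RDEO (subst σ r) := by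
  cases h <;> simp

theorem exists_normalised_instance_LDEO (l : Set TmE) (r : TmE) (σ : ℕ → TmE)
    (h : (l, r) ∈ LDEO') : ∃ l' r' τ, (l', r') ∈ LDEO' ∧
      (∀ u ∈ l', ∃ v ∈ l, subst τ u = normalise RDEO (subst σ v)) ∧
      subst τ r' = normalise RDEO (subst σ r) := by
  have same (hl : ∀ u ∈ l, subst (fun n => normalise RDEO (σ n)) u = normalise RDEO (subst σ u))
      (hr : subst (fun n => normalise RDEO (σ n)) r = normalise RDEO (subst σ r)) :
      ∃ l' r' τ, (l', r') ∈ LDEO' ∧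
        (∀ u ∈ l', ∃ v ∈ l, subst τ u = normalise RDEO (subst σ v)) ∧
        subst τ r' = normalise RDEO (subst σ r) :=
    ⟨l, r, _, h, fun u hu => ⟨u, hu, hl u hu⟩, hr⟩
  simp only [LDEO', LDEO, Set.mem_union, Set.mem_insert_iff, Set.mem_singleton_iff, Prod.mk.injEq,
    or_assoc] at h
  rcases h with ⟨rfl, rfl⟩ | ⟨rfl, rfl⟩ | ⟨rfl, rfl⟩ | ⟨rfl, rfl⟩ |
      ⟨rfl, rfl⟩ | ⟨rfl, rfl⟩ | ⟨rfl, rfl⟩ | ⟨rfl, rfl⟩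
  · rcases contract_eSig_eq_self_or (normalise RDEO (σ 0)) (normalise RDEO (σ 1)) with
      hc | ⟨x, y, hx, hy, hc⟩
    · apply same <;> simp [hc]
    · refine ⟨{eF (ePk yE) (eSig xE (eSk yE)), eSkp (ePk yE) (eSig xE (eSk yE))},
        eSig xE (eSk yE), fun n => if n = 0 then x else y,
        by simp [LDEO'], ?_, ?_⟩
      · simp [hx, hy]
      · simp [hc]
  · rcases contract_eVer_eq_self_or (normalise RDEO (σ 0)) (normalise RDEO (σ 1))
      (normalise RDEO (σ 2)) with hc | hc
    · apply same <;> simp [hc]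
    · refine ⟨∅, eOne, σ, by simp [LDEO', LDEO], by simp, ?_⟩
      simp [hc]
  all_goals apply same <;> simp

end DEO

/-- for any finite set `E` of ground terms in normal form and any
ground term `t` in normal form, `E ↠*_{I'} E, t` iff `E ↠*_{I_∅} E, t`:
derivations modulo the equational theory and modulo the empty theory derive
the same normal terms from normal knowledge (saturated systems I'_DSKS,
I'_DEO). -/
theorem derivations_modulo_iff_syntactic :
    (∀ (E : Set TmD) (t : TmD), E.Finite →
       (∀ u ∈ E, Ground u ∧ NormalForm RDSKS u) →
       Ground t → NormalForm RDSKS t →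
       (Deriv LDSKS' ADSKS E t ↔ DerivSyn LDSKS' E t)) ∧
    (∀ (E : Set TmE) (t : TmE), E.Finite →
       (∀ u ∈ E, Ground u ∧ NormalForm RDEO u) →
       Ground t → NormalForm RDEO t →
       (Deriv LDEO' ADEO E t ↔ DerivSyn LDEO' E t)) := by
  refine ⟨fun E t _ hE _ ht => ⟨?_, DerivSyn.deriv⟩, fun E t _ hE _ ht => ⟨?_, DerivSyn.deriv⟩⟩
  · exact Deriv.derivSyn (fun _ _ σ h => h.normalise_eq σ) exists_normalised_instance_LDSKS
      (fun u hu => (hE u hu).2) ht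
  · exact Deriv.derivSyn (fun _ _ σ h => h.normalise_eq σ) exists_normalised_instance_LDEO
      (fun u hu => (hE u hu).2) ht

end Paper
end

section
/- Let C = {C_α, E ▷ t, C_β} be a constraint system such that the prefix C_α is in solved form. Then for every substitution σ: σ satisfies C if and only if σ satisfies {C_α, (E \ X) ▷ t, C_β}, where E \ X is E with all variables removed. -/
set_option maxHeartbeats 1000000

namespace Paper

section Derivability

variable {Sg : Type} {ar : Sg → ℕ}

theorem DedStepSyn.union {L : Set (Rule Sg ar)} {A B : Set (Tm Sg ar)}
    (h : DedStepSyn L A B) (G : Set (Tm Sg ar)) : DedStepSyn L (A ∪ G) (B ∪ G) := by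
  obtain ⟨l, r, σ, hl, hp, rfl⟩ := h
  exact ⟨l, r, σ, hl, fun u hu => Or.inl (hp u hu), Set.union_right_comm _ _ _⟩

theorem reflTransGen_dedStepSyn_union {L : Set (Rule Sg ar)} {A B : Set (Tm Sg ar)}
    (h : Relation.ReflTransGen (DedStepSyn L) A B) (G : Set (Tm Sg ar)) :
    Relation.ReflTransGen (DedStepSyn L) (A ∪ G) (B ∪ G) :=
  h.lift (· ∪ G) fun _ _ hab => hab.union G

theorem subset_of_reflTransGen_dedStepSyn {L : Set (Rule Sg ar)} {A B : Set (Tm Sg ar)}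
    (h : Relation.ReflTransGen (DedStepSyn L) A B) : A ⊆ B := by
  induction h with
  | refl => exact subset_rfl
  | tail _ hbc ih =>
    obtain ⟨l, r, σ, -, -, rfl⟩ := hbc
    exact ih.trans Set.subset_union_left

theorem DerivSyn.mono {L : Set (Rule Sg ar)} {A B : Set (Tm Sg ar)} {t : Tm Sg ar}
    (h : DerivSyn L A t) (hAB : A ⊆ B) : DerivSyn L B t := by
  obtain ⟨F, hF, ht⟩ := h
  refine ⟨F ∪ B, ?_, Or.inl ht⟩
  simpa only [Set.union_eq_self_of_subset_left hAB] using reflTransGen_dedStepSyn_union hF B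

theorem derivSyn_of_mem {L : Set (Rule Sg ar)} {A : Set (Tm Sg ar)} {t : Tm Sg ar}
    (h : t ∈ A) : DerivSyn L A t :=
  ⟨A, .refl, h⟩

/-- Finitely many derivable terms occur together in a single derivation. -/
theorem exists_reflTransGen_dedStepSyn_superset {L : Set (Rule Sg ar)} {A B : Set (Tm Sg ar)}
    (hB : B.Finite) (h : ∀ u ∈ B, DerivSyn L A u) :
    ∃ G, Relation.ReflTransGen (DedStepSyn L) A G ∧ B ⊆ G := by
  induction B, hB using Set.Finite.induction_on with
  | empty => exact ⟨A, .refl, Set.empty_subset _⟩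
  | @insert b B _ _ ih =>
    obtain ⟨G, hG, hBG⟩ := ih fun u hu => h u (Set.mem_insert_of_mem _ hu)
    obtain ⟨F, hF, hb⟩ := h b (Set.mem_insert _ _)
    have hGF := reflTransGen_dedStepSyn_union hF G
    rw [Set.union_eq_self_of_subset_left (subset_of_reflTransGen_dedStepSyn hG)] at hGF
    exact ⟨F ∪ G, hG.trans hGF,
      Set.insert_subset (Or.inl hb) (hBG.trans Set.subset_union_right)⟩

/-- The intruder deduction system admits cuts on finite sets of terms. -/
theorem DerivSyn.cut {L : Set (Rule Sg ar)} {A B : Set (Tm Sg ar)} {t : Tm Sg ar}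
    (hB : B.Finite) (h : ∀ u ∈ B, DerivSyn L A u) (ht : DerivSyn L B t) : DerivSyn L A t := by
  obtain ⟨G, hG, hBG⟩ := exists_reflTransGen_dedStepSyn_superset hB h
  obtain ⟨F, hF, htF⟩ := ht.mono hBG
  exact ⟨F, hG.trans hF, htF⟩

theorem finite_substList (σ : Subst Sg ar) (E : List (Tm Sg ar)) : (substList σ E).Finite :=
  (E.finite_toSet.image (subst σ)).subset fun _ ⟨e, he, hu⟩ => ⟨e, he, hu.symm⟩

theorem substList_subset (σ : Subst Sg ar) {E E' : List (Tm Sg ar)} (h : E ⊆ E') :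
    substList σ E ⊆ substList σ E' :=
  fun _ ⟨e, he, hu⟩ => ⟨e, h he, hu⟩

/-- The instances of the variables of `E` are derivable from the instances of the other
terms of `E`, as soon as the constraints preceding `E ▷ t` are satisfied. -/
theorem WFG.derivSyn_filter {L : Set (Rule Sg ar)} {σ : Subst Sg ar} {Cα Cβ : GCS Sg ar}
    {E : List (Tm Sg ar)} {t : Tm Sg ar} (hwf : WFG (Cα ++ (E, t) :: Cβ))
    (hα : SatGSyn L σ Cα) (i : ℕ) (hi : i < (Cα ++ (E, t) :: Cβ).length)
    (hle : i ≤ Cα.length) :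
    ∀ u ∈ ((Cα ++ (E, t) :: Cβ).get ⟨i, hi⟩).1,
      DerivSyn L (substList σ (E.filter fun u => !isVarB u)) (subst σ u) := by
  induction i using Nat.strong_induction_on with
  | _ i ih =>
    intro u hu
    have huE : u ∈ E := by
      simpa using hwf.1 i Cα.length hi (by simp) hle u hu
    cases u with
    | var x =>
      obtain ⟨j, hj, hji, hjx⟩ := hwf.2 i hi _ hu x rfl
      have hmem : (Cα ++ (E, t) :: Cβ).get ⟨j, hj⟩ ∈ Cα := by
        simp [List.getElem_append_left (hji.trans_le hle)]
      have hsat := hα _ hmem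
      rw [hjx] at hsat
      refine hsat.cut (finite_substList _ _) ?_
      rintro _ ⟨e, he, rfl⟩
      exact ih j hji hj (hji.le.trans hle) e he
    | cst c => exact derivSyn_of_mem ⟨_, List.mem_filter.2 ⟨huE, rfl⟩, rfl⟩
    | app s a => exact derivSyn_of_mem ⟨_, List.mem_filter.2 ⟨huE, rfl⟩, rfl⟩

end Derivability

/-- if `C = {C_α, E ▷ t, C_β}` is a constraint system whose
prefix `C_α` is in solved form, then a substitution satisfies `C` iff it
satisfies `{C_α, (E \\ X) ▷ t, C_β}`, where all variables are removed from
`E`. -/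
theorem variable_elimination (Sg : Type) (ar : Sg → ℕ) (L : Set (Rule Sg ar))
    (Cα Cβ : GCS Sg ar) (E : List (Tm Sg ar)) (t : Tm Sg ar)
    (hwf : WFG (Cα ++ (E, t) :: Cβ)) (hα : SolvedForm Cα) :
    ∀ σ : Subst Sg ar,
      SatGSyn L σ (Cα ++ (E, t) :: Cβ) ↔
      SatGSyn L σ (Cα ++ (E.filter (fun u => !isVarB u), t) :: Cβ) := by
  intro σ
  simp only [SatGSyn, List.forall_mem_append, List.forall_mem_cons]
  refine and_congr_right fun hsat => and_congr_left fun _ => ⟨fun h => ?_, fun h => ?_⟩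
  · refine h.cut (finite_substList _ _) ?_
    rintro _ ⟨e, he, rfl⟩
    exact hwf.derivSyn_filter hsat Cα.length (by simp) le_rfl e (by simpa using he)
  · exact h.mono (substList_subset σ (List.filter_subset_self _))

end Paper
end

section
/- For every I_DSKS-constraint system C, the application of the transformation rules Apply and Unif (using the saturated deduction rules L'_DSKS, modulo the empty theory) terminates: there is no infinite sequence of transformation steps starting from C. -/
set_option maxHeartbeats 1000000

namespace Paper

section

variable {Sg : Type} {ar : Sg → ℕ}

/-- The variables of a term, as a finset. -/
def fvars : Tm Sg ar → Finset ℕ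
  | .var n => {n}
  | .cst _ => ∅
  | .app _ a => Finset.univ.biUnion fun i => fvars (a i)

/-- The number of function symbols of a term, each symbol `s` being counted `c s` times. -/
def weight (c : Sg → ℕ) : Tm Sg ar → ℕ
  | .var _ => 0
  | .cst _ => 0
  | .app s a => c s + ∑ i, weight c (a i)

/-- The variables of the images under `σ` of the variables in `X`. -/
def imageVars (σ : Subst Sg ar) (X : Finset ℕ) : Finset ℕ := X.biUnion fun n => fvars (σ n)

theorem subst_scomp (τ σ : Subst Sg ar) (t : Tm Sg ar) :
    subst (scomp τ σ) t = subst τ (subst σ t) := by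
  induction t with
  | var n => rfl
  | cst c => rfl
  | app s a ih => simp [subst, ih]

theorem fvars_subst (σ : Subst Sg ar) (t : Tm Sg ar) :
    fvars (subst σ t) = imageVars σ (fvars t) := by
  induction t with
  | var n => simp [subst, fvars, imageVars]
  | cst c => simp [subst, fvars, imageVars]
  | app s a ih =>
    simp only [subst, fvars, ih]
    ext n
    simp [imageVars]
    tauto

theorem imageVars_mono (σ : Subst Sg ar) {X Y : Finset ℕ} (h : X ⊆ Y) :
    imageVars σ X ⊆ imageVars σ Y :=
  Finset.biUnion_subset_biUnion_of_subset_left _ h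

theorem fvars_subst_subset (σ : Subst Sg ar) {t : Tm Sg ar} {X : Finset ℕ} (h : fvars t ⊆ X) :
    fvars (subst σ t) ⊆ imageVars σ X :=
  fvars_subst σ t ▸ imageVars_mono σ h

theorem fvars_arg_subset (s : Sg) (a : Fin (ar s) → Tm Sg ar) (i : Fin (ar s)) :
    fvars (a i) ⊆ fvars (Tm.app s a) :=
  Finset.subset_biUnion_of_mem (fun i => fvars (a i)) (Finset.mem_univ i)

theorem weight_arg_le (c : Sg → ℕ) (s : Sg) (a : Fin (ar s) → Tm Sg ar) (i : Fin (ar s)) :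
    c s + weight c (a i) ≤ weight c (Tm.app s a) :=
  Nat.add_le_add_left
    (Finset.single_le_sum (f := fun i => weight c (a i)) (fun _ _ => Nat.zero_le _)
      (Finset.mem_univ i)) _

theorem weight_subst (c : Sg → ℕ) (σ : Subst Sg ar) (t : Tm Sg ar)
    (h : ∀ n ∈ fvars t, weight c (σ n) = 0) : weight c (subst σ t) = weight c t := by
  induction t with
  | var n => simpa [subst, weight, fvars] using h
  | cst k => rfl
  | app s a ih =>
    simp only [subst, weight]
    congr 1
    exact Finset.sum_congr rfl fun i _ => ih i fun n hn => h n (fvars_arg_subset s a i hn)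

theorem weight_one_le_of_mem_fvars (σ : Subst Sg ar) {x : ℕ} {t : Tm Sg ar} (h : x ∈ fvars t) :
    weight (fun _ => 1) (σ x) ≤ weight (fun _ => 1) (subst σ t) := by
  induction t with
  | var n =>
    obtain rfl : x = n := by simpa [fvars] using h
    exact le_rfl
  | cst c => simp [fvars] at h
  | app s a ih =>
    obtain ⟨i, hi⟩ : ∃ i, x ∈ fvars (a i) := by simpa [fvars] using h
    have h1 := ih i hi
    have h2 := weight_arg_le (fun _ => 1) s (fun i => subst σ (a i)) i
    simp only [subst]
    omega

theorem notMem_fvars_of_unifies {σ : Subst Sg ar} {x : ℕ} {u : Tm Sg ar}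
    (h : σ x = subst σ u) (hne : u ≠ Tm.var x) : x ∉ fvars u := by
  intro hx
  cases u with
  | var n =>
    obtain rfl : x = n := by simpa [fvars] using hx
    exact hne rfl
  | cst c => simp [fvars] at hx
  | app s a =>
    obtain ⟨i, hi⟩ : ∃ i, x ∈ fvars (a i) := by simpa [fvars] using hx
    have h1 := weight_one_le_of_mem_fvars σ hi
    have h2 := weight_arg_le (fun _ => 1) s (fun i => subst σ (a i)) i
    simp only [h, subst] at h1 h2
    omega

/-- Distinct terms unified by `σ` have a disagreement pair made of a variable and a term. -/
theorem exists_disagreement {σ : Subst Sg ar} {s t : Tm Sg ar} (hst : s ≠ t)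
    (h : subst σ s = subst σ t) :
    ∃ x u, u ≠ Tm.var x ∧ x ∈ fvars s ∪ fvars t ∧ fvars u ⊆ fvars s ∪ fvars t ∧
      σ x = subst σ u := by
  induction s generalizing t with
  | var n => exact ⟨n, t, hst.symm, by simp [fvars], Finset.subset_union_right, h⟩
  | cst c =>
    cases t with
    | var m => exact ⟨m, .cst c, hst, by simp [fvars], Finset.subset_union_left, h.symm⟩
    | cst d => exact absurd (by simpa [subst] using h) hst
    | app s b => simp [subst] at h
  | app s a ih =>
    cases t with
    | var m => exact ⟨m, .app s a, hst, by simp [fvars], Finset.subset_union_left, h.symm⟩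
    | cst d => simp [subst] at h
    | app s' b =>
      simp only [subst, Tm.app.injEq] at h
      obtain ⟨rfl, h⟩ := h
      have h := eq_of_heq h
      obtain ⟨i, hi⟩ : ∃ i, a i ≠ b i := by
        by_contra! hab
        exact hst (by rw [funext hab])
      obtain ⟨x, u, hu, hx, hsub, heq⟩ := ih i hi (congrFun h i)
      have hle := Finset.union_subset_union (fvars_arg_subset s a i) (fvars_arg_subset s b i)
      exact ⟨x, u, hu, hle hx, hsub.trans hle, heq⟩

/-- `σ` is most general, as far as the variables in `X` are concerned, among the unifiers of
some system over `X`. -/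
def MostGeneralOn (X : Finset ℕ) (σ : Subst Sg ar) (S : List (Tm Sg ar × Tm Sg ar)) : Prop :=
  (∀ e ∈ S, fvars e.1 ⊆ X ∧ fvars e.2 ⊆ X) ∧ UnifiesSys σ S ∧
    ∀ τ, UnifiesSys τ S → ∃ ρ, ∀ n ∈ X, τ n = subst ρ (σ n)

/-- Elimination of a variable `x` that is solved by a term over the remaining variables. -/
theorem MostGeneralOn.eliminate {X : Finset ℕ} {σ : Subst Sg ar} {x : ℕ} {u : Tm Sg ar}
    (h : ∃ S, MostGeneralOn (insert x X) σ S) (hu : fvars u ⊆ X) (hx : σ x = subst σ u) :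
    ∃ S, MostGeneralOn X σ S := by
  by_cases hmem : x ∈ X
  · rwa [Finset.insert_eq_of_mem hmem] at h
  obtain ⟨S, hS, hun, hgen⟩ := h
  let δ : Subst Sg ar := Function.update Tm.var x u
  have hδ : ∀ t, subst σ (subst δ t) = subst σ t := by
    intro t
    rw [← subst_scomp]
    congr 1
    funext n
    by_cases hn : n = x
    · subst hn; simp [scomp, δ, hx]
    · simp [scomp, δ, hn, subst]
  have hvars : ∀ t, fvars t ⊆ insert x X → fvars (subst δ t) ⊆ X := by
    intro t ht
    refine (fvars_subst_subset δ ht).trans ?_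
    simp only [imageVars, Finset.biUnion_subset, Finset.mem_insert]
    rintro n (rfl | hn)
    · simpa [δ] using hu
    · have : n ≠ x := fun e => hmem (e ▸ hn)
      simpa [δ, this, fvars] using hn
  refine ⟨S.map fun e => (subst δ e.1, subst δ e.2), ?_, ?_, ?_⟩
  · simp only [List.mem_map]
    rintro _ ⟨e, he, rfl⟩
    exact ⟨hvars _ (hS e he).1, hvars _ (hS e he).2⟩
  · simp only [UnifiesSys, List.mem_map]
    rintro _ ⟨e, he, rfl⟩
    simpa only [hδ] using hun e he
  · intro τ hτ
    obtain ⟨ρ, hρ⟩ := hgen (scomp τ δ) fun e he => by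
      simpa only [subst_scomp] using hτ _ (List.mem_map_of_mem he)
    refine ⟨ρ, fun n hn => ?_⟩
    have hne : n ≠ x := fun e => hmem (e ▸ hn)
    rw [← hρ n (Finset.mem_insert_of_mem hn)]
    simp [scomp, δ, hne, subst]

/-- A most general unifier of a system over `X` either decreases the number of variables or maps
the variables in `X` to variables. -/
theorem MostGeneralOn.card_imageVars {X : Finset ℕ} {σ : Subst Sg ar}
    (h : ∃ S, MostGeneralOn X σ S) :
    (imageVars σ X).card < X.card ∨
      (imageVars σ X).card ≤ X.card ∧ ∀ n ∈ X, ∃ m, σ n = Tm.var m := by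
  induction hk : X.card using Nat.strong_induction_on generalizing X with
  | _ k ih =>
    subst hk
    obtain ⟨S, hS⟩ := h
    by_cases htriv : ∀ e ∈ S, e.1 = e.2
    · right
      obtain ⟨ρ, hρ⟩ := hS.2.2 Tm.var fun e he => by rw [htriv e he]
      have hvar : ∀ n ∈ X, ∃ m, σ n = Tm.var m := by
        intro n hn
        have := hρ n hn
        cases hσ : σ n with
        | var m => exact ⟨m, rfl⟩
        | cst c => simp [hσ, subst] at this
        | app s a => simp [hσ, subst] at this
      refine ⟨?_, hvar⟩
      refine (Finset.card_biUnion_le_card_mul X _ 1 fun n hn => ?_).trans (by simp)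
      obtain ⟨m, hm⟩ := hvar n hn
      simp [hm, fvars]
    · left
      push Not at htriv
      obtain ⟨e, he, hne⟩ := htriv
      obtain ⟨x, u, hu, hx, hsub, heq⟩ := exists_disagreement hne (hS.2.1 e he)
      have hle := Finset.union_subset (hS.1 e he).1 (hS.1 e he).2
      have hxX := hle hx
      have huX : fvars u ⊆ X.erase x := fun n hn => Finset.mem_erase.2
        ⟨fun e => notMem_fvars_of_unifies heq hu (e ▸ hn), hle (hsub hn)⟩
      have hel := MostGeneralOn.eliminate (x := x) (X := X.erase x)
        ⟨S, by rwa [Finset.insert_erase hxX]⟩ huX heq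
      have hcard := Finset.card_erase_lt_of_mem hxX
      have hrec := ih _ hcard hel rfl
      have himg : imageVars σ X ⊆ imageVars σ (X.erase x) := by
        refine Finset.biUnion_subset.2 fun n hn => ?_
        by_cases hnx : n = x
        · rw [hnx, heq]
          exact fvars_subst_subset σ huX
        · exact Finset.subset_biUnion_of_mem (fun n => fvars (σ n))
            (Finset.mem_erase.2 ⟨hnx, hn⟩)
      have := Finset.card_le_card himg
      omega

theorem IsMGUSys.mostGeneralOn {σ : Subst Sg ar} {S : List (Tm Sg ar × Tm Sg ar)}
    (h : IsMGUSys σ S) {X : Finset ℕ} (hX : ∀ e ∈ S, fvars e.1 ⊆ X ∧ fvars e.2 ⊆ X) :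
    MostGeneralOn X σ S :=
  ⟨hX, h.1, fun τ hτ => (h.2 τ hτ).imp fun _ hρ n _ => hρ n⟩

theorem IsMGU.isMGUSys {σ : Subst Sg ar} {u t : Tm Sg ar} (h : IsMGU σ u t) :
    IsMGUSys σ [(u, t)] := by
  simpa [IsMGUSys, UnifiesSys, IsMGU, Unifies] using h

/-- The variables of a list of terms. -/
def listVars (E : List (Tm Sg ar)) : Finset ℕ := E.foldr (fun t X => fvars t ∪ X) ∅

/-- The variables of a constraint system. -/
def sysVars (C : GCS Sg ar) : Finset ℕ :=
  C.foldr (fun p X => (listVars p.1 ∪ fvars p.2) ∪ X) ∅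

theorem mem_listVars {E : List (Tm Sg ar)} {n : ℕ} : n ∈ listVars E ↔ ∃ t ∈ E, n ∈ fvars t := by
  induction E with
  | nil => simp [listVars]
  | cons t E ih =>
    simp only [listVars, List.foldr_cons, Finset.mem_union, List.exists_mem_cons_iff] at ih ⊢
    rw [ih]

theorem listVars_subset {E : List (Tm Sg ar)} {X : Finset ℕ} :
    listVars E ⊆ X ↔ ∀ t ∈ E, fvars t ⊆ X := by
  simp only [Finset.subset_iff, mem_listVars]
  exact ⟨fun h t ht n hn => h ⟨t, ht, hn⟩, fun h n ⟨t, ht, hn⟩ => h t ht hn⟩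

theorem sysVars_subset {C : GCS Sg ar} {X : Finset ℕ} :
    sysVars C ⊆ X ↔ ∀ p ∈ C, (∀ t ∈ p.1, fvars t ⊆ X) ∧ fvars p.2 ⊆ X := by
  induction C with
  | nil => simp [sysVars]
  | cons p C ih =>
    simp only [sysVars, List.foldr_cons, Finset.union_subset_iff, List.forall_mem_cons] at ih ⊢
    rw [ih, listVars_subset]

theorem sysVars_csubst_subset {C : GCS Sg ar} {σ : Subst Sg ar} {X : Finset ℕ}
    (h : ∀ p ∈ C, (∀ t ∈ p.1, fvars t ⊆ X) ∧ fvars (subst σ p.2) ⊆ imageVars σ X) :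
    sysVars (csubst σ C) ⊆ imageVars σ X := by
  rw [sysVars_subset]
  simp only [csubst, List.mem_map]
  rintro _ ⟨p, hp, rfl⟩
  refine ⟨?_, (h p hp).2⟩
  simp only [List.mem_map]
  rintro _ ⟨t, ht, rfl⟩
  exact fvars_subst_subset σ ((h p hp).1 t ht)

/-- The weight counting all symbols of the DSKS signature but `SK`. -/
def weightD : TmD → ℕ := weight fun s => match s with
  | .sk => 0
  | _ => 1

/-- The multiset of the weights of the right-hand sides. -/
def rhsWeights (C : GCS SgD arD) : Multiset ℕ := (C.map fun p => weightD p.2 : List ℕ)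

/-- `σ` decreases the number of variables, or neither increases it nor changes the weights of
terms over `X`. -/
def Shrinks (σ : Subst SgD arD) (X : Finset ℕ) : Prop :=
  (imageVars σ X).card < X.card ∨
    (imageVars σ X).card ≤ X.card ∧ ∀ n ∈ X, weightD (σ n) = 0

theorem MostGeneralOn.shrinks {X : Finset ℕ} {σ : Subst SgD arD}
    (h : ∃ S, MostGeneralOn X σ S) : Shrinks σ X :=
  (MostGeneralOn.card_imageVars h).imp id fun ⟨hc, hv⟩ => ⟨hc, fun n hn => by
    obtain ⟨m, hm⟩ := hv n hn
    simp [hm, weightD, weight]⟩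

/-- The order on pairs of a number of variables and a multiset of weights that decreases along
transformation steps. -/
def measureLT : ℕ × Multiset ℕ → ℕ × Multiset ℕ → Prop :=
  Prod.Lex (· < ·) Multiset.IsDershowitzMannaLT

theorem exists_app_of_unifies {σ : Subst Sg ar} {s : Sg} {a : Fin (ar s) → Tm Sg ar}
    {t : Tm Sg ar} (ht : ¬ isVar t) (h : subst σ (Tm.app s a) = subst σ t) :
    ∃ b, t = Tm.app s b ∧ ∀ i, subst σ (a i) = subst σ (b i) := by
  cases t with
  | var n => simp [isVar] at ht
  | cst c => simp [subst] at h
  | app s' b =>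
    simp only [subst, Tm.app.injEq] at h
    obtain ⟨rfl, h⟩ := h
    exact ⟨b, rfl, congrFun (eq_of_heq h)⟩

theorem isVar_iff {t : Tm Sg ar} : isVar t ↔ ∃ n, t = Tm.var n := by
  cases t <;> simp [isVar]

theorem MostGeneralOn.eliminate_finset {X F : Finset ℕ} {σ : Subst Sg ar}
    (h : ∃ S, MostGeneralOn (F ∪ X) σ S)
    (hF : ∀ x ∈ F, ∃ u, fvars u ⊆ X ∧ σ x = subst σ u) : ∃ S, MostGeneralOn X σ S := by
  induction F using Finset.induction_on with
  | empty => simpa using h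
  | insert x F hx ih =>
    obtain ⟨u, hu, hxu⟩ := hF x (Finset.mem_insert_self x F)
    rw [Finset.insert_union] at h
    exact ih (MostGeneralOn.eliminate h (hu.trans Finset.subset_union_right) hxu)
      fun y hy => hF y (Finset.mem_insert_of_mem hy)

/-- The rules of `L_DSKS` have the form `x_0, …, x_{k-1} ↠ s(x_0, …, x_{k-1})`. -/
theorem LDSKS_form {l : Set TmD} {r : TmD} (h : (l, r) ∈ LDSKS) :
    ∃ s, s ≠ SgD.sk ∧ r = Tm.app s (fun i => Tm.var i) ∧
      ∀ u ∈ l, ∃ i : Fin (arD s), u = Tm.var i := by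
  simp only [LDSKS, Set.mem_insert_iff, Set.mem_singleton_iff, Prod.mk.injEq] at h
  rcases h with ⟨rfl, rfl⟩ | ⟨rfl, rfl⟩ | ⟨rfl, rfl⟩ | ⟨rfl, rfl⟩ | ⟨rfl, rfl⟩ | ⟨rfl, rfl⟩
  · refine ⟨.sig, by simp, ?_, ?_⟩
    · exact congrArg (Tm.app SgD.sig) (funext fun i : Fin 2 => by fin_cases i <;> rfl)
    · rintro u (rfl | rfl)
      exacts [⟨(0 : Fin 2), rfl⟩, ⟨(1 : Fin 2), rfl⟩]
  · refine ⟨.ver, by simp, ?_, ?_⟩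
    · exact congrArg (Tm.app SgD.ver) (funext fun i : Fin 3 => by fin_cases i <;> rfl)
    · rintro u (rfl | rfl | rfl)
      exacts [⟨(0 : Fin 3), rfl⟩, ⟨(1 : Fin 3), rfl⟩, ⟨(2 : Fin 3), rfl⟩]
  · refine ⟨.skp, by simp, ?_, ?_⟩
    · exact congrArg (Tm.app SgD.skp) (funext fun i : Fin 2 => by fin_cases i <;> rfl)
    · rintro u (rfl | rfl)
      exacts [⟨(0 : Fin 2), rfl⟩, ⟨(1 : Fin 2), rfl⟩]
  · refine ⟨.pkp, by simp, ?_, ?_⟩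
    · exact congrArg (Tm.app SgD.pkp) (funext fun i : Fin 2 => by fin_cases i <;> rfl)
    · rintro u (rfl | rfl)
      exacts [⟨(0 : Fin 2), rfl⟩, ⟨(1 : Fin 2), rfl⟩]
  · refine ⟨.zero, by simp, ?_, by simp⟩
    exact congrArg (Tm.app SgD.zero) (funext fun i : Fin 0 => i.elim0)
  · refine ⟨.one, by simp, ?_, by simp⟩
    exact congrArg (Tm.app SgD.one) (funext fun i : Fin 0 => i.elim0)

theorem weightD_arg_lt {s : SgD} (hs : s ≠ .sk) (b : Fin (arD s) → TmD) (i : Fin (arD s)) :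
    weightD (b i) < weightD (.app s b) := by
  have h := weight_arg_le (fun s : SgD => match s with
    | .sk => 0
    | _ => 1) s b i
  unfold weightD
  cases s
  case sk => exact absurd rfl hs
  all_goals
    refine Nat.lt_of_lt_of_le ?_ h
    exact Nat.lt_add_of_pos_left Nat.one_pos

theorem fvars_dSig (a b : TmD) : fvars (dSig a b) = fvars a ∪ fvars b := by
  change (Finset.univ : Finset (Fin 2)).biUnion (fun i => fvars ((![a, b] : Fin 2 → TmD) i)) = _
  ext n
  simp

theorem fvars_dSkp (a b : TmD) : fvars (dSkp a b) = fvars a ∪ fvars b := fvars_dSig a b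

theorem fvars_dSk (a : TmD) : fvars (dSk a) = fvars a := by
  change (Finset.univ : Finset (Fin 1)).biUnion (fun i => fvars ((![a] : Fin 1 → TmD) i)) = _
  ext n
  simp

theorem fvars_dPk (a : TmD) : fvars (dPk a) = fvars a := fvars_dSk a

theorem weightD_subst_dSk (σ : Subst SgD arD) (a : TmD) :
    weightD (subst σ (dSk a)) = weightD (subst σ a) := by
  change 0 + ∑ i : Fin 1, weightD (subst σ ((![a] : Fin 1 → TmD) i)) = _
  simp

/-- What an instance of `Apply` with `σ` guarantees: `σ` shrinks `X`, and the new right-hand sides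
are instances of lighter terms. -/
def GoodStep (σ : Subst SgD arD) (X : Finset ℕ) (t : TmD) (l : Set TmD) : Prop :=
  Shrinks σ X ∧ ∀ y ∈ l, isVar y →
    ∃ a, fvars a ⊆ X ∧ subst σ y = subst σ a ∧ weightD a < weightD t

theorem goodStep_of_mem_LDSKS {l : Set TmD} {r t : TmD} {σ : Subst SgD arD} {X : Finset ℕ}
    {S : List (TmD × TmD)} (hr : (l, r) ∈ LDSKS) (ht : ¬ isVar t) (htX : fvars t ⊆ X)
    (hσ : IsMGUSys σ S) (hS : (r, t) ∈ S)
    (hSX : ∀ e ∈ S, (e = (r, t) ∨ fvars e.1 ⊆ X ∧ e.2 ∈ l)) : GoodStep σ X t l := by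
  obtain ⟨s, hs, rfl, hl⟩ := LDSKS_form hr
  obtain ⟨b, rfl, hb⟩ := exists_app_of_unifies ht (hσ.1 _ hS)
  have hbX i : fvars (b i) ⊆ X := (fvars_arg_subset s b i).trans htX
  refine ⟨MostGeneralOn.shrinks (MostGeneralOn.eliminate_finset
    (F := fvars (Tm.app s fun i => (Tm.var i : TmD))) ⟨S, hσ.mostGeneralOn ?_⟩ ?_), ?_⟩
  · intro e he
    rcases hSX e he with rfl | ⟨h1, h2⟩
    · exact ⟨Finset.subset_union_left, htX.trans Finset.subset_union_right⟩
    · refine ⟨h1.trans Finset.subset_union_right, ?_⟩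
      obtain ⟨i, hi⟩ := hl _ h2
      rw [hi]
      exact (fvars_arg_subset s (fun i => (Tm.var i : TmD)) i).trans Finset.subset_union_left
  · intro x hx
    obtain ⟨i, hi⟩ : ∃ i : Fin (arD s), x = i := by simpa [fvars] using hx
    exact ⟨b i, hbX i, hi ▸ hb i⟩
  · intro y hy _
    obtain ⟨i, rfl⟩ := hl y hy
    exact ⟨b i, hbX i, hb i, weightD_arg_lt hs b i⟩

/-- The rules added by saturation: the premises are over `x` and `y`, and `x` is the only
variable among them. -/
theorem goodStep_of_sig_sk {l : Set TmD} {t : TmD} {σ : Subst SgD arD} {X : Finset ℕ}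
    {S : List (TmD × TmD)} (hl : ∀ u ∈ l, fvars u ⊆ {0, 1}) (hlx : ∀ u ∈ l, isVar u → u = xD)
    (ht : ¬ isVar t) (htX : fvars t ⊆ X)
    (hσ : IsMGUSys σ S) (hS : (dSig xD (dSk yD), t) ∈ S)
    (hSX : ∀ e ∈ S, (e = (dSig xD (dSk yD), t) ∨ fvars e.1 ⊆ X ∧ e.2 ∈ l)) :
    GoodStep σ X t l := by
  obtain ⟨b, rfl, hb⟩ := exists_app_of_unifies ht (hσ.1 _ hS)
  have hbX i : fvars (b i) ⊆ X := (fvars_arg_subset _ b i).trans htX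
  have h0 : σ 0 = subst σ (b (0 : Fin 2)) := hb (0 : Fin 2)
  have h1 : subst σ (dSk yD) = subst σ (b (1 : Fin 2)) := hb (1 : Fin 2)
  have hfr : fvars (dSig xD (dSk yD)) ⊆ {0, 1} := by
    intro n hn
    simpa [fvars_dSig, fvars_dSk, fvars, xD, yD] using hn
  have hgen : ∃ S, MostGeneralOn (insert 1 X) σ S := by
    refine MostGeneralOn.eliminate (x := 0) ⟨S, hσ.mostGeneralOn ?_⟩
      ((hbX (0 : Fin 2)).trans (Finset.subset_insert _ _)) h0
    have hsub : ({0, 1} : Finset ℕ) ⊆ insert 0 (insert 1 X) := by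
      intro n; simp; tauto
    have hsub' : X ⊆ insert 0 (insert 1 X) := by
      intro n; simp; tauto
    intro e he
    rcases hSX e he with rfl | ⟨h1, h2⟩
    · exact ⟨hfr.trans hsub, htX.trans hsub'⟩
    · exact ⟨h1.trans hsub', (hl _ h2).trans hsub⟩
  refine ⟨?_, fun y hy hv => ⟨b (0 : Fin 2), hbX _, hlx y hy hv ▸ h0,
    weightD_arg_lt (by simp) b (0 : Fin 2)⟩⟩
  by_cases h1X : 1 ∈ X
  · rw [Finset.insert_eq_of_mem h1X] at hgen
    exact MostGeneralOn.shrinks hgen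
  have hb1X := hbX (1 : Fin 2)
  by_cases hbv : isVar (b (1 : Fin 2))
  · obtain ⟨v, hv⟩ := isVar_iff.1 hbv
    rw [hv] at h1 hb1X
    have hvX : v ∈ X := by simpa [fvars] using hb1X
    have hv1 : v ≠ 1 := fun e => h1X (e ▸ hvX)
    have hins : insert v (insert 1 (X.erase v)) = insert 1 X := by
      rw [Finset.insert_comm, Finset.insert_erase hvX]
    have h1v : 1 ∉ X.erase v := fun h => h1X (Finset.mem_of_mem_erase h)
    have hsk : fvars (dSk yD) ⊆ insert 1 (X.erase v) := by
      intro n hn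
      have : n = 1 := by simpa [fvars_dSk, fvars, yD] using hn
      simp [this]
    have hcard : (insert 1 (X.erase v)).card = X.card := by
      rw [Finset.card_insert_of_notMem h1v, Finset.card_erase_add_one hvX]
    have himg : imageVars σ X ⊆ imageVars σ (insert 1 (X.erase v)) := by
      refine Finset.biUnion_subset.2 fun n hn => ?_
      by_cases hnv : n = v
      · have : σ n = subst σ (dSk yD) := hnv ▸ h1.symm
        rw [this]
        exact fvars_subst_subset σ hsk
      · exact Finset.subset_biUnion_of_mem (fun n => fvars (σ n)) (by simp [hnv, hn])
    have hle := Finset.card_le_card himg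
    rw [← hins] at hgen
    rcases MostGeneralOn.shrinks (MostGeneralOn.eliminate hgen hsk h1.symm) with h | ⟨h, hw⟩
    · exact .inl (by omega)
    · refine .inr ⟨by omega, fun n hn => ?_⟩
      by_cases hnv : n = v
      · have : σ n = subst σ (dSk yD) := hnv ▸ h1.symm
        rw [this, weightD_subst_dSk]
        exact hw 1 (by simp)
      · exact hw n (by simp [hnv, hn])
  · obtain ⟨c, hc, hc'⟩ := exists_app_of_unifies hbv h1
    rw [hc] at hb1X
    exact MostGeneralOn.shrinks (MostGeneralOn.eliminate hgen
      ((fvars_arg_subset _ c (0 : Fin 1)).trans hb1X) (hc' (0 : Fin 1)))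

theorem goodStep_of_mem_LDSKS' {l : Set TmD} {r t : TmD} {σ : Subst SgD arD} {X : Finset ℕ}
    {S : List (TmD × TmD)} (hr : (l, r) ∈ LDSKS') (ht : ¬ isVar t) (htX : fvars t ⊆ X)
    (hσ : IsMGUSys σ S) (hS : (r, t) ∈ S)
    (hSX : ∀ e ∈ S, (e = (r, t) ∨ fvars e.1 ⊆ X ∧ e.2 ∈ l)) : GoodStep σ X t l := by
  rcases hr with hr | hr
  · exact goodStep_of_mem_LDSKS hr ht htX hσ hS hSX
  · simp only [Set.mem_insert_iff, Set.mem_singleton_iff, Prod.mk.injEq] at hr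
    rcases hr with ⟨rfl, rfl⟩ | ⟨rfl, rfl⟩ <;>
    · refine goodStep_of_sig_sk ?_ ?_ ht htX hσ hS hSX
      · rintro u (rfl | rfl) n hn <;>
          simp only [fvars_dSig, fvars_dSk, fvars_dSkp, fvars_dPk, fvars, xD, yD, Finset.mem_union,
            Finset.mem_insert, Finset.mem_singleton] at hn ⊢ <;> tauto
      · rintro u (rfl | rfl) hu
        · rfl
        · simp [isVar, dSk, dSkp] at hu

/-- Replacing the constraint `E ▷ t` by constraints with lighter right-hand sides and applying a
shrinking substitution decreases the measure. -/
theorem measureLT_of_shrinks {Cα Cβ N : GCS SgD arD} {E : List TmD} {t : TmD}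
    {σ : Subst SgD arD} (hσ : Shrinks σ (sysVars (Cα ++ (E, t) :: Cβ)))
    (hN : ∀ p ∈ N, p.1 = E ∧ ∃ a, fvars a ⊆ sysVars (Cα ++ (E, t) :: Cβ) ∧
      subst σ p.2 = subst σ a ∧ weightD a < weightD t) :
    measureLT ((sysVars (csubst σ (Cα ++ N ++ Cβ))).card, rhsWeights (csubst σ (Cα ++ N ++ Cβ)))
      ((sysVars (Cα ++ (E, t) :: Cβ)).card, rhsWeights (Cα ++ (E, t) :: Cβ)) := by
  set X := sysVars (Cα ++ (E, t) :: Cβ) with hX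
  have hCX := sysVars_subset.1 hX.symm.subset
  have hsub : sysVars (csubst σ (Cα ++ N ++ Cβ)) ⊆ imageVars σ X := by
    refine sysVars_csubst_subset fun p hp => ?_
    simp only [List.mem_append] at hp
    rcases hp with (hp | hp) | hp
    · have := hCX p (by simp [hp])
      exact ⟨this.1, fvars_subst_subset σ this.2⟩
    · obtain ⟨hE, a, ha, hpa, -⟩ := hN p hp
      rw [hE, hpa]
      exact ⟨(hCX (E, t) (by simp)).1, fvars_subst_subset σ ha⟩
    · have := hCX p (by simp [hp])
      exact ⟨this.1, fvars_subst_subset σ this.2⟩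
  have hle := Finset.card_le_card hsub
  rcases hσ with h | ⟨h, hw⟩
  · exact Prod.Lex.left _ _ (hle.trans_lt h)
  rcases (hle.trans h).lt_or_eq with h | h
  · exact Prod.Lex.left _ _ h
  rw [h]
  refine Prod.Lex.right _ ?_
  have hkeep : ∀ a, fvars a ⊆ X → weightD (subst σ a) = weightD a :=
    fun a ha => weight_subst _ σ a fun n hn => hw n (ha hn)
  have hmap : ∀ D : GCS SgD arD, (∀ p ∈ D, p ∈ Cα ++ (E, t) :: Cβ) →
      rhsWeights (csubst σ D) = rhsWeights D := by
    intro D hD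
    simp only [rhsWeights, csubst, List.map_map, Multiset.coe_eq_coe]
    refine List.Perm.of_eq (List.map_congr_left fun p hp => ?_)
    exact hkeep _ (hCX p (hD p hp)).2
  have happ : ∀ A B : GCS SgD arD, rhsWeights (A ++ B) = rhsWeights A + rhsWeights B := by
    intro A B
    simp [rhsWeights]
  refine ⟨rhsWeights Cα + rhsWeights Cβ, rhsWeights (csubst σ N), {weightD t}, by simp, ?_, ?_, ?_⟩
  · have : csubst σ (Cα ++ N ++ Cβ) = csubst σ Cα ++ csubst σ N ++ csubst σ Cβ := by
      simp [csubst]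
    rw [this, happ, happ, hmap Cα (fun p hp => by simp [hp]), hmap Cβ (fun p hp => by simp [hp])]
    exact add_right_comm _ _ _
  · have : rhsWeights ((E, t) :: Cβ) = {weightD t} + rhsWeights Cβ := happ [(E, t)] Cβ
    rw [happ, this, add_comm {weightD t}, add_assoc]
  · intro y hy
    obtain ⟨p, hp, rfl⟩ : ∃ p ∈ N, weightD (subst σ p.2) = y := by
      simpa [rhsWeights, csubst] using hy
    obtain ⟨-, a, ha, hpa, hlt⟩ := hN p hp
    refine ⟨weightD t, by simp, ?_⟩
    rwa [hpa, hkeep a ha]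

theorem TStep.measureLT {C C' : GCS SgD arD} (h : TStep LDSKS' C C') :
    measureLT ((sysVars C').card, rhsWeights C') ((sysVars C).card, rhsWeights C) := by
  cases h with
  | @unif Cα Cβ E t u σ _ _ hu _ hσ =>
    have hE := sysVars_subset.1 (Finset.Subset.refl (sysVars (Cα ++ (E, t) :: Cβ))) (E, t) (by simp)
    have := measureLT_of_shrinks (N := []) (MostGeneralOn.shrinks
      ⟨_, hσ.isMGUSys.mostGeneralOn (X := sysVars (Cα ++ (E, t) :: Cβ)) (by
        simpa using ⟨hE.1 u hu, hE.2⟩)⟩) (by simp)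
    simpa using this
  | @apply Cα Cβ E t r l lx lnl el σ _ ht hr hlx hl _ hel hσ =>
    have hE := sysVars_subset.1 (Finset.Subset.refl (sysVars (Cα ++ (E, t) :: Cβ))) (E, t) (by simp)
    have hgood : GoodStep σ (sysVars (Cα ++ (E, t) :: Cβ)) t l := by
      refine goodStep_of_mem_LDSKS' hr ht hE.2 hσ (by simp) fun e he => ?_
      rcases List.mem_append.1 he with he | he
      · have he := List.of_mem_zip (a := e.1) (b := e.2) he
        exact .inr ⟨hE.1 _ (hel _ he.1), (hl _).2 (.inr he.2)⟩
      · exact .inl (by simpa using he)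
    refine measureLT_of_shrinks hgood.1 ?_
    simp only [List.mem_map]
    rintro _ ⟨y, hy, rfl⟩
    exact ⟨rfl, hgood.2 y ((hl y).2 (.inl hy)) (hlx y hy)⟩

theorem wellFounded_measureLT : WellFounded measureLT :=
  WellFounded.prod_lex wellFounded_lt Multiset.wellFounded_isDershowitzMannaLT

end

/-- for every I_DSKS-constraint system, the application of the
transformation rules Apply and Unif (with the saturated rules L'_DSKS, modulo
the empty theory) terminates: there is no infinite sequence of transformation
steps. -/
theorem transformation_terminates_DSKS (C : GCS SgD arD) :
    ¬ ∃ f : ℕ → GCS SgD arD, f 0 = C ∧ ∀ n, TStep LDSKS' (f n) (f (n + 1)) := by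
  rintro ⟨f, -, hf⟩
  exact (wellFounded_iff_isEmpty_descending_chain.1 wellFounded_measureLT).false
    ⟨fun n => ((sysVars (f n)).card, rhsWeights (f n)), fun n => (hf n).measureLT⟩

end Paper
end
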